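/- arXiv:2106.02263 — 6 statements merged into one kernel-verified Lean document; each statement's English description precedes it below -/
import Mathlib

section
/- Let δ ∈ (0, 1/4) and L > 0. Suppose f is Borel measurable with |f(x)| ≤ L(1 + ‖x‖) for all x ∈ 𝒳, that ∫ ‖x‖^{2+δ} dπ₁(x) < ∞, and that M := ∫ ∫ ‖y‖^{2+δ} d(κ x)(y) dπ₁(x) < ∞. Then the series of integrals Iₙ := ∫_𝒳 ∫ Δₙ(x,z) d(κ x)^{⊗2ⁿ}(z) dπ₁(x) is absolutely convergent (i.e. ∑_{n=0}^∞ ∫_𝒳 ∫ |Δₙ(x,z)| d(κ x)^{⊗2ⁿ}(z) dπ₁(x) < ∞) and ∑_{n=0}^∞ Iₙ = ∫_𝒳 max{f(x), m(x)} dπ₁(x). (This is the unbiasedness identity underlying Theorem 1(1): the MUSE Δ_N/p_r(N) has expectation E[max{f(X₁), E[f(X₂)|X₁]}].) -/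
open MeasureTheory ProbabilityTheory

noncomputable section

variable {X : Type*}

/-- The full empirical average `Aₙ(z) = 2^{−n} ∑_{i<2ⁿ} f(zᵢ)`. -/
def avgFull (f : X → ℝ) (n : ℕ) (z : ℕ → X) : ℝ :=
  (∑ i ∈ Finset.range (2 ^ n), f (z i)) / 2 ^ n

/-- The odd-position average `Aₙᴼ(z) = 2^{−(n−1)} ∑_{j<2^{n−1}} f(z_{2j})`. -/
def avgOdd (f : X → ℝ) (n : ℕ) (z : ℕ → X) : ℝ :=
  (∑ j ∈ Finset.range (2 ^ (n - 1)), f (z (2 * j))) / 2 ^ (n - 1)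

/-- The even-position average `Aₙᴱ(z) = 2^{−(n−1)} ∑_{j<2^{n−1}} f(z_{2j+1})`. -/
def avgEven (f : X → ℝ) (n : ℕ) (z : ℕ → X) : ℝ :=
  (∑ j ∈ Finset.range (2 ^ (n - 1)), f (z (2 * j + 1))) / 2 ^ (n - 1)

/-- The antithetic difference `Δₙ(x,z)`; for `n = 0`, `Δ₀(x,z) = max{f(x), f(z₀)}`. -/
def antitheticDelta (f : X → ℝ) (n : ℕ) (x : X) (z : ℕ → X) : ℝ :=
  if n = 0 then max (f x) (f (z 0))
  else max (f x) (avgFull f n z)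
    - (max (f x) (avgOdd f n z) + max (f x) (avgEven f n z)) / 2

/-- Extend a `2ⁿ`-tuple to a function on `ℕ` (only the first `2ⁿ` coordinates are
ever used by `antitheticDelta`). -/
def tupleExt (n : ℕ) (z : Fin (2 ^ n) → X) : ℕ → X :=
  fun i => z ⟨i % 2 ^ n, Nat.mod_lt _ (Nat.two_pow_pos n)⟩

lemma measurePreserving_pi_precomp [MeasurableSpace X] (μ : Measure X) [IsProbabilityMeasure μ]
    {ι ι' : Type*} [Fintype ι] [Fintype ι'] {g : ι' → ι} (hg : g.Injective) :
    MeasurePreserving (fun (z : ι → X) (j : ι') => z (g j))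
      (Measure.pi fun _ => μ) (Measure.pi fun _ => μ) := by
  refine ⟨by fun_prop, ?_⟩
  have h : iIndepFun (fun (i : ι) (z : ι → X) => z i) (Measure.pi fun _ => μ) :=
    iIndepFun_pi (X := fun _ => id) fun _ => aemeasurable_id
  rw [(iIndepFun_iff_map_fun_eq_pi_map fun j => (measurable_pi_apply (g j)).aemeasurable).1 (h.precomp hg)]
  congr 1
  ext1 j
  exact (measurePreserving_eval (fun _ : ι => μ) (g j)).map_eq

lemma avgFull_tupleExt (f : X → ℝ) (n : ℕ) (z : Fin (2 ^ n) → X) :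
    avgFull f n (tupleExt n z) = (∑ i, f (z i)) / 2 ^ n := by
  simp only [avgFull, tupleExt, Finset.sum_range]
  congr 1
  refine Finset.sum_congr rfl fun i _ => ?_
  congr 2
  exact Fin.ext (Nat.mod_eq_of_lt i.2)

/-- The position of the `j`-th entry of the first half of the antithetic pair. -/
def oddPos (n : ℕ) (j : Fin (2 ^ n)) : Fin (2 ^ (n + 1)) :=
  ⟨2 * j, by have := j.2; rw [pow_succ]; omega⟩

/-- The position of the `j`-th entry of the second half of the antithetic pair. -/
def evenPos (n : ℕ) (j : Fin (2 ^ n)) : Fin (2 ^ (n + 1)) :=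
  ⟨2 * j + 1, by have := j.2; rw [pow_succ]; omega⟩

lemma oddPos_injective (n : ℕ) : (oddPos n).Injective := fun i j h => by
  have := congrArg Fin.val h
  simp only [oddPos] at this
  omega

lemma evenPos_injective (n : ℕ) : (evenPos n).Injective := fun i j h => by
  have := congrArg Fin.val h
  simp only [evenPos] at this
  omega

lemma avgOdd_tupleExt (f : X → ℝ) (n : ℕ) (z : Fin (2 ^ (n + 1)) → X) :
    avgOdd f (n + 1) (tupleExt (n + 1) z)
      = avgFull f n (tupleExt n fun j => z (oddPos n j)) := by
  rw [avgFull_tupleExt]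
  simp only [avgOdd, tupleExt, Finset.sum_range, Nat.add_sub_cancel]
  congr 1
  refine Finset.sum_congr rfl fun i _ => ?_
  congr 2
  exact Fin.ext (Nat.mod_eq_of_lt (oddPos n i).2)

lemma avgEven_tupleExt (f : X → ℝ) (n : ℕ) (z : Fin (2 ^ (n + 1)) → X) :
    avgEven f (n + 1) (tupleExt (n + 1) z)
      = avgFull f n (tupleExt n fun j => z (evenPos n j)) := by
  rw [avgFull_tupleExt]
  simp only [avgEven, tupleExt, Finset.sum_range, Nat.add_sub_cancel]
  congr 1
  refine Finset.sum_congr rfl fun i _ => ?_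
  congr 2
  exact Fin.ext (Nat.mod_eq_of_lt (evenPos n i).2)

lemma antitheticDelta_zero_tupleExt (f : X → ℝ) (x : X) (z : Fin (2 ^ 0) → X) :
    antitheticDelta f 0 x (tupleExt 0 z) = max (f x) (avgFull f 0 (tupleExt 0 z)) := by
  simp [antitheticDelta, avgFull]

lemma antitheticDelta_succ_tupleExt (f : X → ℝ) (n : ℕ) (x : X) (z : Fin (2 ^ (n + 1)) → X) :
    antitheticDelta f (n + 1) x (tupleExt (n + 1) z)
      = max (f x) (avgFull f (n + 1) (tupleExt (n + 1) z))
        - (max (f x) (avgFull f n (tupleExt n fun j => z (oddPos n j)))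
          + max (f x) (avgFull f n (tupleExt n fun j => z (evenPos n j)))) / 2 := by
  rw [antitheticDelta, if_neg n.succ_ne_zero, avgOdd_tupleExt, avgEven_tupleExt]

lemma measurable_avgFull_tupleExt [MeasurableSpace X] {f : X → ℝ} (hf : Measurable f) (n : ℕ) :
    Measurable fun z : Fin (2 ^ n) → X => avgFull f n (tupleExt n z) := by
  simp only [avgFull_tupleExt]
  fun_prop

lemma lintegral_abs_avgFull_sub_integral_le [MeasurableSpace X] (μ : Measure X)
    [IsProbabilityMeasure μ] {f : X → ℝ} (hf : Measurable f) (n : ℕ) :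
    ∫⁻ z : Fin (2 ^ n) → X, ENNReal.ofReal |avgFull f n (tupleExt n z) - ∫ y, f y ∂μ|
        ∂(Measure.pi fun _ => μ)
      ≤ ENNReal.ofReal ((3 / 4) ^ n) * (1 + ∫⁻ y, ENNReal.ofReal (f y ^ 2) ∂μ) := by
  have hc : (0 : ℝ) < (3 / 4) ^ n := by positivity
  by_cases hq : ∫⁻ y, ENNReal.ofReal (f y ^ 2) ∂μ = ⊤
  · rw [hq, add_top, ENNReal.mul_top (ENNReal.ofReal_pos.2 hc).ne']
    exact le_top
  have hint : Integrable (fun y => f y ^ 2) μ :=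
    (lintegral_ofReal_ne_top_iff_integrable (by fun_prop)
      (ae_of_all _ fun y => sq_nonneg _)).1 hq
  have h2 : MemLp f 2 μ := (memLp_two_iff_integrable_sq hf.aestronglyMeasurable).2 hint
  set m := ∫ y, f y ∂μ
  set P : Measure (Fin (2 ^ n) → X) := Measure.pi fun _ => μ
  set A : (Fin (2 ^ n) → X) → ℝ := fun z => avgFull f n (tupleExt n z)
  have hterm : ∀ i : Fin (2 ^ n), MemLp (fun z : Fin (2 ^ n) → X => f (z i)) 2 P := fun i =>
    h2.comp_measurePreserving (measurePreserving_eval (fun _ => μ) i)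
  have hA : A = fun z => (2 ^ n : ℝ)⁻¹ * (∑ i, fun z : Fin (2 ^ n) → X => f (z i)) z := by
    ext z
    simp only [A, avgFull_tupleExt, Finset.sum_apply]
    ring
  have hA2 : MemLp A 2 P := by
    rw [hA]
    exact (memLp_finsetSum' _ fun i _ => hterm i).const_mul _
  have hmean : ∫ z, A z ∂P = m := by
    simp only [A, avgFull_tupleExt]
    rw [integral_div, integral_finsetSum _ fun i _ => (hterm i).integrable one_le_two]
    have : ∀ i : Fin (2 ^ n), ∫ z, f (z i) ∂P = m := fun i =>
      integral_comp_eval (μ := fun _ : Fin (2 ^ n) => μ) hf.aestronglyMeasurable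
    simp [this]
  have hvar : Var[A; P] = Var[f; μ] / 2 ^ n := by
    rw [hA, variance_const_mul, variance_sum_pi (X := fun _ => f) fun _ => h2]
    simp
    field_simp
  have hsq : Integrable (fun z => (A z - m) ^ 2) P :=
    (hA2.sub (memLp_const m)).integrable_sq
  have hle : Var[f; μ] ≤ ∫ y, f y ^ 2 ∂μ := by
    simpa using variance_le_expectation_sq (μ := μ) hf.aestronglyMeasurable
  calc ∫⁻ z, ENNReal.ofReal |A z - m| ∂P
      ≤ ∫⁻ z, ENNReal.ofReal ((3 / 4) ^ n + (4 / 3) ^ n * (A z - m) ^ 2) ∂P := by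
        refine lintegral_mono fun z => ENNReal.ofReal_le_ofReal ?_
        have h1 : ((3 / 4 : ℝ) ^ n) * (4 / 3) ^ n = 1 := by rw [← mul_pow]; norm_num
        have h3 : (0 : ℝ) < (4 / 3) ^ n := by positivity
        rw [← sq_abs]
        set t := |A z - m|
        nlinarith [mul_nonneg h3.le (sq_nonneg (t - (3 / 4) ^ n)), abs_nonneg (A z - m)]
    _ = ENNReal.ofReal ((3 / 4) ^ n + (4 / 3) ^ n * (Var[f; μ] / 2 ^ n)) := by
        have hsum : Integrable (fun z => (3 / 4 : ℝ) ^ n + (4 / 3) ^ n * (A z - m) ^ 2) P :=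
          (integrable_const _).add (hsq.const_mul _)
        rw [← ofReal_integral_eq_lintegral_ofReal hsum (ae_of_all _ fun z => by positivity),
          integral_add (integrable_const _) (hsq.const_mul _), integral_const_mul, ← hvar,
          variance_eq_integral hA2.aemeasurable, hmean]
        simp
    _ ≤ ENNReal.ofReal ((3 / 4) ^ n * (1 + ∫ y, f y ^ 2 ∂μ)) := by
        refine ENNReal.ofReal_le_ofReal ?_
        have h1 : (4 / 3 : ℝ) ^ n * (Var[f; μ] / 2 ^ n) = (2 / 3) ^ n * Var[f; μ] := by
          rw [show (2 / 3 : ℝ) = 4 / 3 / 2 by norm_num, div_pow (4 / 3 : ℝ)]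
          ring
        have h3 : (2 / 3 : ℝ) ^ n ≤ (3 / 4) ^ n := pow_le_pow_left₀ (by norm_num) (by norm_num) n
        rw [h1, mul_add, mul_one]
        exact add_le_add_right (mul_le_mul h3 hle (variance_nonneg _ _) hc.le) _
    _ = _ := by
        rw [ENNReal.ofReal_mul hc.le, ENNReal.ofReal_add zero_le_one (by positivity),
          ofReal_integral_eq_lintegral_ofReal hint (ae_of_all _ fun y => sq_nonneg _),
          ENNReal.ofReal_one]

/-- The kernel `x ↦ (κ x)^{⊗ι}`. -/
def piKernel [MeasurableSpace X] (ι : Type*) [Fintype ι] (κ : Kernel X X) [IsMarkovKernel κ] :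
    Kernel X (ι → X) where
  toFun x := Measure.pi fun _ => κ x
  measurable' := by
    refine Measurable.measure_of_isPiSystem_of_isProbabilityMeasure generateFrom_pi.symm
      isPiSystem_pi ?_
    rintro _ ⟨s, hs, rfl⟩
    simp_rw [Measure.pi_pi]
    exact Finset.measurable_prod _ fun i _ => κ.measurable_coe (hs i (Set.mem_univ i))

lemma piKernel_apply [MeasurableSpace X] (ι : Type*) [Fintype ι] (κ : Kernel X X)
    [IsMarkovKernel κ] (x : X) : piKernel ι κ x = Measure.pi fun _ => κ x := rfl

instance [MeasurableSpace X] (ι : Type*) [Fintype ι] (κ : Kernel X X) [IsMarkovKernel κ] :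
    IsMarkovKernel (piKernel ι κ) :=
  ⟨fun x => by rw [piKernel_apply]; infer_instance⟩

lemma abs_max_sub_max_le (a b c : ℝ) : |max a b - max a c| ≤ |b - c| := by
  simpa using abs_max_sub_max_le_max a b a c

lemma measurable_integral_kernel [MeasurableSpace X] (κ : Kernel X X) [IsMarkovKernel κ]
    {f : X → ℝ} (hf : Measurable f) : Measurable fun x => ∫ y, f y ∂(κ x) :=
  hf.stronglyMeasurable.integral_kernel.measurable

section MarkovPair

variable [MeasurableSpace X] {π : Measure X} {κ : Kernel X X} [IsMarkovKernel κ] {f : X → ℝ}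

lemma measurable_avgFull_sub_integral_kernel (hf : Measurable f) (n : ℕ) :
    Measurable fun p : X × (Fin (2 ^ n) → X) =>
      avgFull f n (tupleExt n p.2) - ∫ y, f y ∂(κ p.1) :=
  ((measurable_avgFull_tupleExt hf n).comp measurable_snd).sub
    ((measurable_integral_kernel κ hf).comp measurable_fst)

lemma measurable_max_avgFull (hf : Measurable f) (n : ℕ) :
    Measurable fun p : X × (Fin (2 ^ n) → X) => max (f p.1) (avgFull f n (tupleExt n p.2)) :=
  (hf.comp measurable_fst).max ((measurable_avgFull_tupleExt hf n).comp measurable_snd)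

lemma lintegral_abs_integral_kernel_le [IsProbabilityMeasure π] :
    ∫⁻ x, ‖∫ y, f y ∂(κ x)‖ₑ ∂π ≤ 1 + ∫⁻ x, ∫⁻ y, ENNReal.ofReal (f y ^ 2) ∂(κ x) ∂π := by
  calc ∫⁻ x, ‖∫ y, f y ∂(κ x)‖ₑ ∂π
      ≤ ∫⁻ x, (1 + ∫⁻ y, ENNReal.ofReal (f y ^ 2) ∂(κ x)) ∂π := by
        refine lintegral_mono fun x => (enorm_integral_le_lintegral_enorm f).trans ?_
        calc ∫⁻ y, ‖f y‖ₑ ∂(κ x) ≤ ∫⁻ y, (1 + ENNReal.ofReal (f y ^ 2)) ∂(κ x) := by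
              refine lintegral_mono fun y => ?_
              rw [Real.enorm_eq_ofReal_abs, ← ENNReal.ofReal_one,
                ← ENNReal.ofReal_add zero_le_one (sq_nonneg _), ← sq_abs]
              exact ENNReal.ofReal_le_ofReal (by nlinarith [sq_nonneg (|f y| - 1), abs_nonneg (f y)])
          _ = _ := by rw [lintegral_add_left measurable_const]; simp
    _ = _ := by rw [lintegral_add_left measurable_const]; simp

lemma integrable_max_integral_kernel [IsProbabilityMeasure π] (hf : Measurable f)
    (hfint : Integrable f π)
    (hq : ∫⁻ x, ∫⁻ y, ENNReal.ofReal (f y ^ 2) ∂(κ x) ∂π ≠ ⊤) :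
    Integrable (fun x => max (f x) (∫ y, f y ∂(κ x))) π := by
  refine hfint.sup ⟨(measurable_integral_kernel κ hf).aestronglyMeasurable, ?_⟩
  exact lintegral_abs_integral_kernel_le.trans_lt
    (ENNReal.add_lt_top.2 ⟨ENNReal.one_lt_top, hq.lt_top⟩)

lemma lintegral_abs_avgFull_sub_integral_kernel_le [IsProbabilityMeasure π] (hf : Measurable f)
    (n : ℕ) :
    ∫⁻ p, ‖avgFull f n (tupleExt n p.2) - ∫ y, f y ∂(κ p.1)‖ₑ ∂(π ⊗ₘ piKernel (Fin (2 ^ n)) κ)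
      ≤ ENNReal.ofReal ((3 / 4) ^ n)
        * (1 + ∫⁻ x, ∫⁻ y, ENNReal.ofReal (f y ^ 2) ∂(κ x) ∂π) := by
  rw [Measure.lintegral_compProd (measurable_avgFull_sub_integral_kernel hf n).enorm]
  calc _ ≤ ∫⁻ x, ENNReal.ofReal ((3 / 4) ^ n)
          * (1 + ∫⁻ y, ENNReal.ofReal (f y ^ 2) ∂(κ x)) ∂π := by
        refine lintegral_mono fun x => ?_
        simp only [Real.enorm_eq_ofReal_abs]
        exact lintegral_abs_avgFull_sub_integral_le (κ x) hf n
    _ = _ := by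
        rw [lintegral_const_mul' _ _ ENNReal.ofReal_ne_top, lintegral_add_left measurable_const]
        simp

lemma integrable_avgFull_sub_integral_kernel [IsProbabilityMeasure π] (hf : Measurable f)
    (hq : ∫⁻ x, ∫⁻ y, ENNReal.ofReal (f y ^ 2) ∂(κ x) ∂π ≠ ⊤) (n : ℕ) :
    Integrable (fun p : X × (Fin (2 ^ n) → X) =>
      avgFull f n (tupleExt n p.2) - ∫ y, f y ∂(κ p.1)) (π ⊗ₘ piKernel (Fin (2 ^ n)) κ) := by
  refine ⟨(measurable_avgFull_sub_integral_kernel hf n).aestronglyMeasurable, ?_⟩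
  exact (lintegral_abs_avgFull_sub_integral_kernel_le hf n).trans_lt
    (ENNReal.mul_lt_top ENNReal.ofReal_lt_top
      (ENNReal.add_lt_top.2 ⟨ENNReal.one_lt_top, hq.lt_top⟩))

lemma integrable_max_integral_kernel_fst [IsProbabilityMeasure π] (hf : Measurable f)
    (hfint : Integrable f π)
    (hq : ∫⁻ x, ∫⁻ y, ENNReal.ofReal (f y ^ 2) ∂(κ x) ∂π ≠ ⊤) (n : ℕ) :
    Integrable (fun p : X × (Fin (2 ^ n) → X) => max (f p.1) (∫ y, f y ∂(κ p.1)))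
      (π ⊗ₘ piKernel (Fin (2 ^ n)) κ) := by
  have h := integrable_max_integral_kernel (κ := κ) hf hfint hq
  rw [← Measure.fst_compProd π (piKernel (Fin (2 ^ n)) κ)] at h
  exact h.comp_measurable measurable_fst

lemma integrable_max_avgFull [IsProbabilityMeasure π] (hf : Measurable f)
    (hfint : Integrable f π)
    (hq : ∫⁻ x, ∫⁻ y, ENNReal.ofReal (f y ^ 2) ∂(κ x) ∂π ≠ ⊤) (n : ℕ) :
    Integrable (fun p : X × (Fin (2 ^ n) → X) => max (f p.1) (avgFull f n (tupleExt n p.2)))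
      (π ⊗ₘ piKernel (Fin (2 ^ n)) κ) := by
  have h := integrable_max_integral_kernel_fst (κ := κ) hf hfint hq n
  have hdiff : Integrable (fun p : X × (Fin (2 ^ n) → X) =>
      max (f p.1) (avgFull f n (tupleExt n p.2)) - max (f p.1) (∫ y, f y ∂(κ p.1)))
      (π ⊗ₘ piKernel (Fin (2 ^ n)) κ) := by
    refine (integrable_avgFull_sub_integral_kernel hf hq n).mono
      (Measurable.aestronglyMeasurable ?_) (ae_of_all _ fun p => abs_max_sub_max_le _ _ _)
    exact (measurable_max_avgFull hf n).sub
      ((hf.comp measurable_fst).max ((measurable_integral_kernel κ hf).comp measurable_fst))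
  exact (hdiff.add h).congr (ae_of_all _ fun p => sub_add_cancel _ _)

lemma abs_integral_max_avgFull_sub_le [IsProbabilityMeasure π] (hf : Measurable f)
    (hfint : Integrable f π)
    (hq : ∫⁻ x, ∫⁻ y, ENNReal.ofReal (f y ^ 2) ∂(κ x) ∂π ≠ ⊤) (n : ℕ) :
    |∫ x, ∫ z : Fin (2 ^ n) → X, max (f x) (avgFull f n (tupleExt n z))
        ∂(Measure.pi fun _ => κ x) ∂π - ∫ x, max (f x) (∫ y, f y ∂(κ x)) ∂π|
      ≤ (3 / 4) ^ n * (1 + ∫⁻ x, ∫⁻ y, ENNReal.ofReal (f y ^ 2) ∂(κ x) ∂π).toReal := by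
  have hG := integrable_max_avgFull (κ := κ) hf hfint hq n
  have hH := integrable_max_integral_kernel_fst (κ := κ) hf hfint hq n
  have hG' := Measure.integral_compProd hG
  have hH' := Measure.integral_compProd hH
  simp only [integral_const, probReal_univ, one_smul] at hH'
  simp only [piKernel_apply] at hG'
  rw [← hG', ← hH', ← integral_sub hG hH]
  have hD := integrable_avgFull_sub_integral_kernel (π := π) (κ := κ) hf hq n
  calc _ ≤ ∫ p, ‖avgFull f n (tupleExt n p.2) - ∫ y, f y ∂(κ p.1)‖
          ∂(π ⊗ₘ piKernel (Fin (2 ^ n)) κ) :=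
        norm_integral_le_of_norm_le (f := fun p : X × (Fin (2 ^ n) → X) =>
          max (f p.1) (avgFull f n (tupleExt n p.2)) - max (f p.1) (∫ y, f y ∂(κ p.1)))
          hD.norm (ae_of_all _ fun p => abs_max_sub_max_le _ _ _)
    _ ≤ (ENNReal.ofReal ((3 / 4) ^ n)
          * (1 + ∫⁻ x, ∫⁻ y, ENNReal.ofReal (f y ^ 2) ∂(κ x) ∂π)).toReal := by
        rw [integral_norm_eq_lintegral_enorm hD.aestronglyMeasurable]
        exact ENNReal.toReal_mono (ENNReal.mul_ne_top ENNReal.ofReal_ne_top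
          (ENNReal.add_ne_top.2 ⟨ENNReal.one_ne_top, hq⟩))
          (lintegral_abs_avgFull_sub_integral_kernel_le hf n)
    _ = _ := by rw [ENNReal.toReal_mul, ENNReal.toReal_ofReal (by positivity)]

lemma integral_antitheticDelta_succ [IsProbabilityMeasure π] (hf : Measurable f)
    (hfint : Integrable f π)
    (hq : ∫⁻ x, ∫⁻ y, ENNReal.ofReal (f y ^ 2) ∂(κ x) ∂π ≠ ⊤) (n : ℕ) :
    ∫ x, ∫ z : Fin (2 ^ (n + 1)) → X, antitheticDelta f (n + 1) x (tupleExt (n + 1) z)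
        ∂(Measure.pi fun _ => κ x) ∂π
      = ∫ x, ∫ z : Fin (2 ^ (n + 1)) → X, max (f x) (avgFull f (n + 1) (tupleExt (n + 1) z))
          ∂(Measure.pi fun _ => κ x) ∂π
        - ∫ x, ∫ z : Fin (2 ^ n) → X, max (f x) (avgFull f n (tupleExt n z))
          ∂(Measure.pi fun _ => κ x) ∂π := by
  have hG := integrable_max_avgFull (κ := κ) hf hfint hq n
  have hG' := integrable_max_avgFull (κ := κ) hf hfint hq (n + 1)
  have hI := MeasureTheory.Integrable.integral_compProd hG
  have hI' := MeasureTheory.Integrable.integral_compProd hG'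
  simp only [Kernel.prodMkLeft_apply, Kernel.const_apply, piKernel_apply] at hI hI'
  rw [← integral_sub hI' hI]
  refine integral_congr_ae ?_
  filter_upwards [((Measure.integrable_compProd_iff hG.aestronglyMeasurable).1 hG).1,
    ((Measure.integrable_compProd_iff hG'.aestronglyMeasurable).1 hG').1] with x hx hx'
  simp only [piKernel_apply] at hx hx'
  have hodd := measurePreserving_pi_precomp (κ x) (oddPos_injective n)
  have heven := measurePreserving_pi_precomp (κ x) (evenPos_injective n)
  have iodd := hodd.integrable_comp_of_integrable hx
  have ieven := heven.integrable_comp_of_integrable hx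
  have eodd := integral_map hodd.measurable.aemeasurable
    (hodd.map_eq.symm ▸ hx.aestronglyMeasurable)
  have eeven := integral_map heven.measurable.aemeasurable
    (heven.map_eq.symm ▸ hx.aestronglyMeasurable)
  rw [hodd.map_eq] at eodd
  rw [heven.map_eq] at eeven
  simp only [Function.comp_def] at iodd ieven
  simp only [antitheticDelta_succ_tupleExt]
  refine (integral_sub hx' ((iodd.add ieven).div_const 2)).trans ?_
  simp only [Pi.add_apply]
  rw [integral_div, integral_add iodd ieven,
    ← eodd, ← eeven, add_self_div_two]

lemma lintegral_abs_antitheticDelta_zero_lt_top [IsProbabilityMeasure π] (hf : Measurable f)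
    (hfint : Integrable f π)
    (hq : ∫⁻ x, ∫⁻ y, ENNReal.ofReal (f y ^ 2) ∂(κ x) ∂π ≠ ⊤) :
    ∫⁻ x, ∫⁻ z : Fin (2 ^ 0) → X, ENNReal.ofReal |antitheticDelta f 0 x (tupleExt 0 z)|
        ∂(Measure.pi fun _ => κ x) ∂π < ⊤ := by
  have h := (integrable_max_avgFull (κ := κ) hf hfint hq 0).hasFiniteIntegral
  rw [HasFiniteIntegral, Measure.lintegral_compProd (measurable_max_avgFull hf 0).enorm] at h
  simpa only [antitheticDelta_zero_tupleExt, Real.enorm_eq_ofReal_abs, piKernel_apply] using h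

lemma lintegral_abs_antitheticDelta_succ_le [IsProbabilityMeasure π] (hf : Measurable f)
    (n : ℕ) :
    ∫⁻ x, ∫⁻ z : Fin (2 ^ (n + 1)) → X,
        ENNReal.ofReal |antitheticDelta f (n + 1) x (tupleExt (n + 1) z)|
        ∂(Measure.pi fun _ => κ x) ∂π
      ≤ ENNReal.ofReal (3 * (3 / 4) ^ n)
        * (1 + ∫⁻ x, ∫⁻ y, ENNReal.ofReal (f y ^ 2) ∂(κ x) ∂π) := by
  calc _ ≤ ∫⁻ x, ENNReal.ofReal (3 * (3 / 4) ^ n)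
          * (1 + ∫⁻ y, ENNReal.ofReal (f y ^ 2) ∂(κ x)) ∂π := by
        refine lintegral_mono fun x => ?_
        set m := ∫ y, f y ∂(κ x)
        have hmeas : ∀ k, Measurable fun z : Fin (2 ^ k) → X =>
            ENNReal.ofReal |avgFull f k (tupleExt k z) - m| := fun k =>
          ((measurable_avgFull_tupleExt hf k).sub_const m).abs.ennreal_ofReal
        have hodd := measurePreserving_pi_precomp (κ x) (oddPos_injective n)
        have heven := measurePreserving_pi_precomp (κ x) (evenPos_injective n)
        have hmeas_odd : Measurable fun z : Fin (2 ^ (n + 1)) → X =>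
            ENNReal.ofReal |avgFull f n (tupleExt n fun j => z (oddPos n j)) - m| :=
          (hmeas n).comp hodd.measurable
        have hn := lintegral_abs_avgFull_sub_integral_le (κ x) hf n
        have hn' := lintegral_abs_avgFull_sub_integral_le (κ x) hf (n + 1)
        have hpow : ENNReal.ofReal ((3 / 4) ^ (n + 1)) ≤ ENNReal.ofReal ((3 / 4) ^ n) :=
          ENNReal.ofReal_le_ofReal
            (pow_le_pow_of_le_one (by norm_num) (by norm_num) n.le_succ)
        calc ∫⁻ z : Fin (2 ^ (n + 1)) → X,
              ENNReal.ofReal |antitheticDelta f (n + 1) x (tupleExt (n + 1) z)|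
                ∂(Measure.pi fun _ => κ x)
            ≤ ∫⁻ z : Fin (2 ^ (n + 1)) → X,
                (ENNReal.ofReal |avgFull f (n + 1) (tupleExt (n + 1) z) - m|
                + (ENNReal.ofReal |avgFull f n (tupleExt n fun j => z (oddPos n j)) - m|
                + ENNReal.ofReal |avgFull f n (tupleExt n fun j => z (evenPos n j)) - m|))
                ∂(Measure.pi fun _ => κ x) := by
              refine lintegral_mono fun z => ?_
              rw [← ENNReal.ofReal_add (abs_nonneg _) (abs_nonneg _),
                ← ENNReal.ofReal_add (abs_nonneg _) (by positivity),
                antitheticDelta_succ_tupleExt]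
              refine ENNReal.ofReal_le_ofReal ?_
              generalize avgFull f (n + 1) (tupleExt (n + 1) z) = c
              generalize avgFull f n (tupleExt n fun j => z (oddPos n j)) = a
              generalize avgFull f n (tupleExt n fun j => z (evenPos n j)) = b
              have h1 := abs_le.1 (abs_max_sub_max_le (f x) c m)
              have h2 := abs_le.1 (abs_max_sub_max_le (f x) a m)
              have h3 := abs_le.1 (abs_max_sub_max_le (f x) b m)
              have h4 := abs_nonneg (a - m)
              have h5 := abs_nonneg (b - m)
              exact abs_le.2 ⟨by linarith, by linarith⟩
          _ ≤ ENNReal.ofReal ((3 / 4) ^ n) * (1 + ∫⁻ y, ENNReal.ofReal (f y ^ 2) ∂(κ x))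
              + (ENNReal.ofReal ((3 / 4) ^ n) * (1 + ∫⁻ y, ENNReal.ofReal (f y ^ 2) ∂(κ x))
              + ENNReal.ofReal ((3 / 4) ^ n)
                * (1 + ∫⁻ y, ENNReal.ofReal (f y ^ 2) ∂(κ x))) := by
              rw [lintegral_add_left (hmeas (n + 1)),
                lintegral_add_left hmeas_odd]
              refine add_le_add (hn'.trans (mul_le_mul_left hpow _)) (add_le_add ?_ ?_)
              · rwa [← hodd.lintegral_comp (hmeas n)] at hn
              · rwa [← heven.lintegral_comp (hmeas n)] at hn
          _ = _ := by
              rw [ENNReal.ofReal_mul (by norm_num), ENNReal.ofReal_ofNat]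
              ring
    _ = _ := by
        rw [lintegral_const_mul' _ _ ENNReal.ofReal_ne_top, lintegral_add_left measurable_const]
        simp

lemma tsum_lintegral_abs_antitheticDelta_lt_top [IsProbabilityMeasure π] (hf : Measurable f)
    (hfint : Integrable f π)
    (hq : ∫⁻ x, ∫⁻ y, ENNReal.ofReal (f y ^ 2) ∂(κ x) ∂π ≠ ⊤) :
    ∑' n : ℕ, ∫⁻ x, ∫⁻ z : Fin (2 ^ n) → X,
        ENNReal.ofReal |antitheticDelta f n x (tupleExt n z)|
          ∂(Measure.pi fun _ => κ x) ∂π < ⊤ := by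
  rw [tsum_eq_zero_add' ENNReal.summable]
  refine ENNReal.add_lt_top.2 ⟨lintegral_abs_antitheticDelta_zero_lt_top hf hfint hq, ?_⟩
  refine (ENNReal.tsum_le_tsum fun n => lintegral_abs_antitheticDelta_succ_le hf n).trans_lt ?_
  rw [ENNReal.tsum_mul_right, ← ENNReal.ofReal_tsum_of_nonneg (fun n => by positivity)
    ((summable_geometric_of_lt_one (by norm_num) (by norm_num)).mul_left 3)]
  exact ENNReal.mul_lt_top ENNReal.ofReal_lt_top
    (ENNReal.add_lt_top.2 ⟨ENNReal.one_lt_top, hq.lt_top⟩)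

lemma tsum_integral_antitheticDelta [IsProbabilityMeasure π] (hf : Measurable f)
    (hfint : Integrable f π)
    (hq : ∫⁻ x, ∫⁻ y, ENNReal.ofReal (f y ^ 2) ∂(κ x) ∂π ≠ ⊤) :
    ∑' n : ℕ, ∫ x, ∫ z : Fin (2 ^ n) → X,
        antitheticDelta f n x (tupleExt n z) ∂(Measure.pi fun _ => κ x) ∂π
      = ∫ x, max (f x) (∫ y, f y ∂(κ x)) ∂π := by
  set I : ℕ → ℝ := fun n => ∫ x, ∫ z : Fin (2 ^ n) → X,
    antitheticDelta f n x (tupleExt n z) ∂(Measure.pi fun _ => κ x) ∂π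
  set B : ℕ → ℝ := fun n => ∫ x, ∫ z : Fin (2 ^ n) → X,
    max (f x) (avgFull f n (tupleExt n z)) ∂(Measure.pi fun _ => κ x) ∂π
  set b := ∫ x, max (f x) (∫ y, f y ∂(κ x)) ∂π
  set C := (1 + ∫⁻ x, ∫⁻ y, ENNReal.ofReal (f y ^ 2) ∂(κ x) ∂π).toReal
  have hB : ∀ n, |B n - b| ≤ (3 / 4) ^ n * C := abs_integral_max_avgFull_sub_le hf hfint hq
  have hI0 : I 0 = B 0 := by simp only [I, B, antitheticDelta_zero_tupleExt]
  have hI : ∀ n, I (n + 1) = B (n + 1) - B n := integral_antitheticDelta_succ hf hfint hq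
  have hgeom : Summable fun n : ℕ => (3 / 4 : ℝ) ^ n * C :=
    (summable_geometric_of_lt_one (by norm_num) (by norm_num)).mul_right C
  have hsum : Summable I := by
    refine (summable_nat_add_iff 1).1 (Summable.of_norm_bounded
      (((summable_nat_add_iff 1).2 hgeom).add hgeom) fun n => ?_)
    rw [hI, ← sub_sub_sub_cancel_right _ _ b]
    exact (norm_sub_le _ _).trans (add_le_add (hB (n + 1)) (hB n))
  have hpartial : ∀ n, ∑ k ∈ Finset.range (n + 1), I k = B n := by
    intro n
    induction n with
    | zero => simpa using hI0
    | succ n ih => rw [Finset.sum_range_succ, ih, hI]; ring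
  have hlim : Filter.Tendsto B Filter.atTop (nhds b) :=
    tendsto_iff_norm_sub_tendsto_zero.2
      (squeeze_zero (fun n => norm_nonneg _) hB hgeom.tendsto_atTop_zero)
  refine tendsto_nhds_unique ?_ hlim
  simpa only [Function.comp_def, hpartial] using
    hsum.hasSum.tendsto_sum_nat.comp (Filter.tendsto_add_atTop_nat 1)

end MarkovPair

lemma one_add_sq_le_rpow {t δ : ℝ} (ht : 0 ≤ t) (hδ : 0 < δ) :
    (1 + t) ^ 2 ≤ 4 * (1 + t ^ (2 + δ)) := by
  have hpos : 0 ≤ t ^ (2 + δ) := Real.rpow_nonneg ht _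
  rcases le_total t 1 with h | h
  · nlinarith
  · have : t ^ 2 ≤ t ^ (2 + δ) := by
      rw [← Real.rpow_natCast]
      exact Real.rpow_le_rpow_of_exponent_le h (by push_cast; linarith)
    nlinarith

lemma ofReal_sq_le_of_linear_growth [NormedAddCommGroup X] {f : X → ℝ} {δ L : ℝ} (hδ : 0 < δ)
    (hgrowth : ∀ x, |f x| ≤ L * (1 + ‖x‖)) (x : X) :
    ENNReal.ofReal (f x ^ 2)
      ≤ ENNReal.ofReal (4 * L ^ 2) * (1 + ENNReal.ofReal (‖x‖ ^ (2 + δ))) := by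
  rw [← ENNReal.ofReal_one, ← ENNReal.ofReal_add zero_le_one (by positivity),
    ← ENNReal.ofReal_mul (by positivity)]
  refine ENNReal.ofReal_le_ofReal ?_
  calc f x ^ 2 = |f x| ^ 2 := (sq_abs _).symm
    _ ≤ (L * (1 + ‖x‖)) ^ 2 := pow_le_pow_left₀ (abs_nonneg _) (hgrowth x) 2
    _ = L ^ 2 * (1 + ‖x‖) ^ 2 := mul_pow _ _ _
    _ ≤ L ^ 2 * (4 * (1 + ‖x‖ ^ (2 + δ))) :=
        mul_le_mul_of_nonneg_left (one_add_sq_le_rpow (norm_nonneg x) hδ) (sq_nonneg L)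
    _ = _ := by ring

lemma lintegral_ofReal_sq_le_of_linear_growth [NormedAddCommGroup X] [MeasurableSpace X]
    (μ : Measure X) [IsProbabilityMeasure μ] {f : X → ℝ} {δ L : ℝ} (hδ : 0 < δ)
    (hgrowth : ∀ x, |f x| ≤ L * (1 + ‖x‖)) :
    ∫⁻ x, ENNReal.ofReal (f x ^ 2) ∂μ
      ≤ ENNReal.ofReal (4 * L ^ 2) * (1 + ∫⁻ x, ENNReal.ofReal (‖x‖ ^ (2 + δ)) ∂μ) := by
  refine (lintegral_mono fun x => ofReal_sq_le_of_linear_growth hδ hgrowth x).trans_eq ?_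
  rw [lintegral_const_mul' _ _ ENNReal.ofReal_ne_top, lintegral_add_left measurable_const]
  simp

/-- Unbiasedness identity underlying Theorem 1(1): the series of integrals
`Iₙ = ∫∫ Δₙ` is absolutely convergent and sums to `∫ max{f(x), m(x)} dπ₁(x)`. -/
theorem muse_two_stage_unbiased
    [NormedAddCommGroup X] [NormedSpace ℝ X] [MeasurableSpace X] [BorelSpace X]
    [TopologicalSpace.SeparableSpace X]
    (π₁ : Measure X) [IsProbabilityMeasure π₁]
    (κ : Kernel X X) [IsMarkovKernel κ]
    (f : X → ℝ) (δ L : ℝ) (hδ : 0 < δ) (hδ' : δ < 1/4) (hL : 0 < L)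
    (hf : Measurable f) (hgrowth : ∀ x, |f x| ≤ L * (1 + ‖x‖))
    (hπ : ∫⁻ x, ENNReal.ofReal (‖x‖ ^ (2 + δ)) ∂π₁ < ⊤)
    (hM : ∫⁻ x, ∫⁻ y, ENNReal.ofReal (‖y‖ ^ (2 + δ)) ∂(κ x) ∂π₁ < ⊤) :
    (∑' n : ℕ, ∫⁻ x, ∫⁻ z : Fin (2 ^ n) → X,
        ENNReal.ofReal |antitheticDelta f n x (tupleExt n z)|
          ∂(Measure.pi fun _ => κ x) ∂π₁ < ⊤) ∧
    (∑' n : ℕ, ∫ x, ∫ z : Fin (2 ^ n) → X,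
        antitheticDelta f n x (tupleExt n z) ∂(Measure.pi fun _ => κ x) ∂π₁)
      = ∫ x, max (f x) (∫ y, f y ∂(κ x)) ∂π₁ := by
  have hC : ENNReal.ofReal (4 * L ^ 2) < ⊤ := ENNReal.ofReal_lt_top
  have hq : ∫⁻ x, ∫⁻ y, ENNReal.ofReal (f y ^ 2) ∂(κ x) ∂π₁ ≠ ⊤ := by
    refine ((lintegral_mono fun x =>
      lintegral_ofReal_sq_le_of_linear_growth (κ x) hδ hgrowth).trans_lt ?_).ne
    rw [lintegral_const_mul' _ _ hC.ne, lintegral_add_left measurable_const]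
    exact ENNReal.mul_lt_top hC (ENNReal.add_lt_top.2 ⟨by simp, hM⟩)
  have hsq : ∫⁻ x, ENNReal.ofReal (f x ^ 2) ∂π₁ ≠ ⊤ :=
    ((lintegral_ofReal_sq_le_of_linear_growth π₁ hδ hgrowth).trans_lt
      (ENNReal.mul_lt_top hC (ENNReal.add_lt_top.2 ⟨ENNReal.one_lt_top, hπ⟩))).ne
  have hfint : Integrable f π₁ :=
    ((memLp_two_iff_integrable_sq hf.aestronglyMeasurable).2
      ((lintegral_ofReal_ne_top_iff_integrable (hf.pow_const 2).aestronglyMeasurable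
        (ae_of_all _ fun y => sq_nonneg _)).1 hsq)).integrable one_le_two
  exact ⟨tsum_lintegral_abs_antitheticDelta_lt_top hf hfint hq,
    tsum_integral_antitheticDelta hf hfint hq⟩
end
end

section
/- (Conditional Marcinkiewicz–Zygmund inequality, Corollary A.2 in kernel form.) For every real p > 2 there exists a constant C_p > 0, depending only on p, such that: for every measurable space Ω₁, every probability measure μ on Ω₁, every Markov kernel κ from Ω₁ to ℝ with ∫_{Ω₁} ∫_ℝ |z|^p d(κ ω)(z) dμ(ω) < ∞, and every n ≥ 1, writing m(ω) := ∫ z d(κ ω)(z), one has ∫_{Ω₁} ∫_{ℝⁿ} |n^{−1} ∑_{i=1}^n z_i − m(ω)|^p d(κ ω)^{⊗n}(z) dμ(ω) ≤ C_p · n^{−p/2} · ∫_{Ω₁} ∫_ℝ |z|^p d(κ ω)(z) dμ(ω). -/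
open MeasureTheory ProbabilityTheory

theorem abs_add_rpow_le {p : ℝ} (hp : 0 ≤ p) (a b : ℝ) :
    |a + b| ^ p ≤ 2 ^ p * (|a| ^ p + |b| ^ p) := by
  have hmax : |a + b| ≤ 2 * max |a| |b| := by
    linarith [abs_add_le a b, le_max_left |a| |b|, le_max_right |a| |b|]
  have h0 : 0 ≤ max |a| |b| := le_max_of_le_left (abs_nonneg a)
  calc |a + b| ^ p ≤ (2 * max |a| |b|) ^ p := Real.rpow_le_rpow (abs_nonneg _) hmax hp
    _ = 2 ^ p * max |a| |b| ^ p := Real.mul_rpow (by norm_num) h0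
    _ ≤ 2 ^ p * (|a| ^ p + |b| ^ p) := by
      gcongr
      have ha : 0 ≤ |a| ^ p := by positivity
      have hb : 0 ≤ |b| ^ p := by positivity
      rcases max_choice |a| |b| with h | h <;> rw [h] <;> linarith

/-- Convexity of `y ↦ y ^ q`: the tangent at `y`, evaluated at `1`. -/
theorem rpow_sub_one_le_tangent {q y : ℝ} (hq : 1 < q) (hy : 0 ≤ y) :
    y ^ q - 1 ≤ q * y ^ (q - 1) * (y - 1) := by
  rcases hy.eq_or_lt with rfl | hy
  · rw [Real.zero_rpow (by linarith), Real.zero_rpow (by linarith)]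
    norm_num
  · have hinv : 0 < y⁻¹ := inv_pos.2 hy
    have h := one_add_mul_self_le_rpow_one_add (s := y⁻¹ - 1) (by linarith) hq.le
    rw [add_sub_cancel, Real.inv_rpow hy.le] at h
    have hpos : 0 < y ^ q := by positivity
    have h2 := mul_le_mul_of_nonneg_left h hpos.le
    rw [mul_inv_cancel₀ hpos.ne'] at h2
    have h3 : y ^ (q - 1) = y ^ q * y⁻¹ := by
      rw [Real.rpow_sub_one hy.ne', div_eq_mul_inv]
    have h4 : y⁻¹ * y = 1 := inv_mul_cancel₀ hy.ne'
    rw [h3]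
    have h5 : q * (y ^ q * y⁻¹) * (y - 1) = q * y ^ q * (1 - y⁻¹) := by
      linear_combination q * y ^ q * h4
    rw [h5]
    linarith

theorem exists_abs_one_add_rpow_le {p : ℝ} (hp : 2 < p) :
    ∃ C : ℝ, 1 ≤ C ∧ ∀ u : ℝ, |1 + u| ^ p ≤ 1 + p * u + C * (u ^ 2 + |u| ^ p) := by
  have h2 : (1 : ℝ) ≤ 2 ^ p := Real.one_le_rpow (by norm_num) (by linarith)
  have hpp : 0 ≤ p * (p - 1) * 2 ^ p := by
    have : 0 ≤ p - 1 := by linarith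
    positivity
  refine ⟨2 ^ p + p + p * (p - 1) * 2 ^ p, by linarith, fun u => ?_⟩
  have hu2 : 0 ≤ u ^ 2 := sq_nonneg u
  have hup : 0 ≤ |u| ^ p := by positivity
  rcases le_total 1 |u| with hu | hu
  · have h3 : |u| ≤ |u| ^ p := Real.self_le_rpow_of_one_le hu (by linarith)
    have h4 : |1 + u| ^ p ≤ (2 * |u|) ^ p := by
      refine Real.rpow_le_rpow (abs_nonneg _) ?_ (by linarith)
      have := abs_add_le 1 u
      rw [abs_one] at this
      linarith
    rw [Real.mul_rpow (by norm_num) (abs_nonneg _)] at h4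
    have h5 : -(p * |u| ^ p) ≤ p * u := by
      have := neg_abs_le u
      nlinarith
    have h6 : 0 ≤ (2 ^ p + p + p * (p - 1) * 2 ^ p) * u ^ 2 := by positivity
    have h7 : 0 ≤ p * (p - 1) * 2 ^ p * |u| ^ p := by positivity
    nlinarith
  · obtain ⟨hl, hr⟩ := abs_le.1 hu
    have hy : 0 ≤ 1 + u := by linarith
    rw [abs_of_nonneg hy]
    have ht := rpow_sub_one_le_tangent (q := p) (by linarith) hy
    rw [add_sub_cancel_left] at ht
    have key : u * ((1 + u) ^ (p - 1) - 1) ≤ (p - 1) * 2 ^ p * u ^ 2 := by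
      rcases le_total 0 u with h0 | h0
      · have h3 := rpow_sub_one_le_tangent (q := p - 1) (by linarith) hy
        rw [add_sub_cancel_left] at h3
        have h4 : (1 + u) ^ (p - 1 - 1) ≤ 2 ^ p :=
          (Real.rpow_le_rpow hy (by linarith) (by linarith)).trans
            (Real.rpow_le_rpow_of_exponent_le (by norm_num) (by linarith))
        have h5 : (p - 1) * (1 + u) ^ (p - 1 - 1) * u ≤ (p - 1) * 2 ^ p * u := by
          have : 0 ≤ p - 1 := by linarith
          gcongr
        nlinarith
      · have h3 := one_add_mul_self_le_rpow_one_add (s := u) hl (p := p - 1) (by linarith)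
        have h4 : (p - 1) * u ^ 2 ≤ (p - 1) * u ^ 2 * 2 ^ p :=
          le_mul_of_one_le_right (by nlinarith) h2
        nlinarith
    have h6 : 0 ≤ (2 ^ p + p) * u ^ 2 := by positivity
    have h7 : 0 ≤ (2 ^ p + p + p * (p - 1) * 2 ^ p) * |u| ^ p := by positivity
    nlinarith

theorem exists_abs_add_rpow_le_taylor {p : ℝ} (hp : 2 < p) :
    ∃ C : ℝ, 1 ≤ C ∧ ∀ s x : ℝ,
      |s + x| ^ p ≤ |s| ^ p + p * (s * |s| ^ (p - 2) * x)
        + C * (|s| ^ (p - 2) * x ^ 2 + |x| ^ p) := by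
  obtain ⟨C, hC, h⟩ := exists_abs_one_add_rpow_le hp
  refine ⟨C, hC, fun s x => ?_⟩
  rcases eq_or_ne s 0 with rfl | hs
  · have : 0 ≤ |x| ^ p := by positivity
    simp only [zero_add, abs_zero, zero_mul, mul_zero, Real.zero_rpow (show p ≠ 0 by linarith),
      Real.zero_rpow (show p - 2 ≠ 0 by linarith)]
    nlinarith
  · have hx : s * (x / s) = x := mul_div_cancel₀ x hs
    generalize x / s = u at hx
    subst hx
    have hs' : 0 < |s| := abs_pos.2 hs
    have e1 : |s| ^ p = |s| ^ (p - 2) * s ^ 2 := by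
      rw [← sq_abs s, ← Real.rpow_natCast |s| 2, ← Real.rpow_add hs']
      norm_num
    have h1 := mul_le_mul_of_nonneg_left (h u) (show 0 ≤ |s| ^ p by positivity)
    rw [show s + s * u = s * (1 + u) by ring, abs_mul, abs_mul,
      Real.mul_rpow hs'.le (abs_nonneg _), Real.mul_rpow hs'.le (abs_nonneg _)]
    refine h1.trans_eq ?_
    rw [e1]
    ring

theorem abs_rpow_mul_sq_le {p ε : ℝ} (hp : 2 < p) (hε : 0 < ε) (s x : ℝ) :
    |s| ^ (p - 2) * x ^ 2 ≤ ε * |s| ^ p + ε⁻¹ ^ (p / 2 - 1) * |x| ^ p := by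
  have split : ∀ y : ℝ, |y| ^ p = |y| ^ (p - 2) * y ^ 2 := fun y => by
    rw [← sq_abs y, ← Real.rpow_natCast |y| 2, ← Real.rpow_add_of_nonneg (abs_nonneg _)
      (by linarith) (by norm_num)]
    norm_num
  have hsq : ∀ y : ℝ, |y| ^ (p - 2) = (y ^ 2) ^ (p / 2 - 1) := fun y => by
    rw [← sq_abs y, ← Real.rpow_natCast |y| 2, ← Real.rpow_mul (abs_nonneg _)]
    congr 1
    push_cast
    ring
  have h1 : 0 ≤ ε * |s| ^ p := by positivity
  have h2 : 0 ≤ ε⁻¹ ^ (p / 2 - 1) * |x| ^ p := by positivity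
  rcases le_total (x ^ 2) (ε * s ^ 2) with h | h
  · have := mul_le_mul_of_nonneg_left h (show 0 ≤ |s| ^ (p - 2) by positivity)
    rw [split s] at h1 ⊢
    linarith
  · have h3 : |s| ^ (p - 2) ≤ ε⁻¹ ^ (p / 2 - 1) * |x| ^ (p - 2) := by
      rw [hsq s, hsq x, ← Real.mul_rpow (by positivity) (by positivity)]
      refine Real.rpow_le_rpow (by positivity) ?_ (by linarith)
      rwa [inv_mul_eq_div, le_div_iff₀' hε]
    have := mul_le_mul_of_nonneg_right h3 (sq_nonneg x)
    rw [mul_assoc, ← split x] at this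
    linarith

/-- Taylor-type bound whose quadratic error is split with weight `t`. -/
theorem exists_abs_add_rpow_le {p : ℝ} (hp : 2 < p) :
    ∃ B : ℝ, 1 ≤ B ∧ ∀ t : ℝ, 1 ≤ t → ∀ s x : ℝ,
      |s + x| ^ p ≤ (1 + t⁻¹) * |s| ^ p + p * (s * |s| ^ (p - 2) * x)
        + B * t ^ (p / 2 - 1) * |x| ^ p := by
  obtain ⟨C, hC, h⟩ := exists_abs_add_rpow_le_taylor hp
  have hC0 : 0 < C := by linarith
  refine ⟨C * C ^ (p / 2 - 1) + C, ?_, fun t ht s x => ?_⟩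
  · have : 0 ≤ C * C ^ (p / 2 - 1) := by positivity
    linarith
  · have ht0 : 0 < t := by linarith
    have h1 := abs_rpow_mul_sq_le hp (inv_pos.2 (mul_pos hC0 ht0)) s x
    rw [inv_inv, Real.mul_rpow hC0.le ht0.le] at h1
    have h2 := mul_le_mul_of_nonneg_left h1 hC0.le
    have e : C * ((C * t)⁻¹ * |s| ^ p + C ^ (p / 2 - 1) * t ^ (p / 2 - 1) * |x| ^ p)
        = t⁻¹ * |s| ^ p + C * C ^ (p / 2 - 1) * t ^ (p / 2 - 1) * |x| ^ p := by
      field_simp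
    rw [e] at h2
    have h3 : 1 ≤ t ^ (p / 2 - 1) := Real.one_le_rpow ht (by linarith)
    have h4 : C * |x| ^ p ≤ C * |x| ^ p * t ^ (p / 2 - 1) :=
      le_mul_of_one_le_right (by positivity) h3
    have h5 := h s x
    nlinarith

theorem add_one_rpow_growth {p B K t : ℝ} (hp : 2 < p) (ht : 1 ≤ t)
    (hK : 0 ≤ K) (hBK : B ≤ K * (p / 2 - 1)) :
    (1 + t⁻¹) * (K * t ^ (p / 2)) + B * t ^ (p / 2 - 1) ≤ K * (t + 1) ^ (p / 2) := by
  have ht0 : 0 < t := by linarith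
  have hb := one_add_mul_self_le_rpow_one_add (s := t⁻¹)
    (by linarith [inv_pos.2 ht0]) (p := p / 2) (by linarith)
  have e : t + 1 = t * (1 + t⁻¹) := by field_simp
  have e2 : t ^ (p / 2) * t⁻¹ = t ^ (p / 2 - 1) := by
    rw [Real.rpow_sub_one ht0.ne']
    exact (div_eq_mul_inv _ _).symm
  rw [e, Real.mul_rpow ht0.le (by positivity)]
  have h1 := mul_le_mul_of_nonneg_left hb (show 0 ≤ K * t ^ (p / 2) by positivity)
  have h2 := mul_le_mul_of_nonneg_right hBK (show 0 ≤ t ^ (p / 2 - 1) by positivity)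
  rw [← e2] at h2 ⊢
  nlinarith

theorem exists_integral_abs_sum_rpow_le {p : ℝ} (hp : 2 < p) :
    ∃ K : ℝ, 0 < K ∧ ∀ {Ω ι : Type*} [MeasurableSpace Ω] (P : Measure Ω) [IsProbabilityMeasure P]
      (X : ι → Ω → ℝ), iIndepFun X P → (∀ i, MemLp (X i) (ENNReal.ofReal p) P) →
      (∀ i, ∫ ω, X i ω ∂P = 0) → ∀ M : ℝ, (∀ i, ∫ ω, |X i ω| ^ p ∂P ≤ M) →
      ∀ s : Finset ι, ∫ ω, |∑ i ∈ s, X i ω| ^ p ∂P ≤ K * (s.card : ℝ) ^ (p / 2) * M := by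
  classical
  obtain ⟨B, hB, hTaylor⟩ := exists_abs_add_rpow_le hp
  have hp2 : 0 < p / 2 - 1 := by linarith
  have hKB : B ≤ max 1 (B / (p / 2 - 1)) * (p / 2 - 1) := by
    rw [← div_le_iff₀ hp2]
    exact le_max_right _ _
  have hK1 : 1 ≤ max 1 (B / (p / 2 - 1)) := le_max_left _ _
  generalize max 1 (B / (p / 2 - 1)) = K at hKB hK1
  refine ⟨K, by linarith, fun {Ω ι} _ P _ X hX hLp hmean M hM s => ?_⟩
  have hp0 : p ≠ 0 := by linarith
  have hpow_int : ∀ {Y : Ω → ℝ}, MemLp Y (ENNReal.ofReal p) P →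
      Integrable (fun ω => |Y ω| ^ p) P := fun hY => by
    simpa [ENNReal.toReal_ofReal (show 0 ≤ p by linarith)] using hY.integrable_norm_rpow'
  induction s using Finset.induction_on with
  | empty => simp [Real.zero_rpow hp0, Real.zero_rpow (show p / 2 ≠ 0 by linarith)]
  | insert a s ha ih =>
    have hM0 : 0 ≤ M := (integral_nonneg fun ω => by positivity).trans (hM a)
    rcases s.eq_empty_or_nonempty with rfl | hs
    · have := hM a
      simp only [insert_empty_eq, Finset.sum_singleton, Finset.card_singleton, Nat.cast_one,
        Real.one_rpow, mul_one]
      nlinarith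
    · have ht : (1 : ℝ) ≤ s.card := by exact_mod_cast hs.card_pos
      set S : Ω → ℝ := fun ω => ∑ i ∈ s, X i ω with hS
      have hSLp : MemLp S (ENNReal.ofReal p) P := memLp_finsetSum s fun i _ => hLp i
      have hindep : IndepFun S (X a) P := by
        have := hX.indepFun_finsetSum_of_notMem₀
          (fun i => (hLp i).aestronglyMeasurable.aemeasurable) ha
        convert this using 1
        ext ω
        simp [hS]
      have hgm : Measurable fun r : ℝ => r * |r| ^ (p - 2) := by fun_prop
      have hgint : Integrable (fun ω => S ω * |S ω| ^ (p - 2)) P := by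
        refine ((integrable_const (1 : ℝ)).add (hpow_int hSLp)).mono'
          (hgm.comp_aemeasurable hSLp.aestronglyMeasurable.aemeasurable).aestronglyMeasurable
          (ae_of_all _ fun ω => ?_)
        have hnn : 0 ≤ |S ω| ^ p := by positivity
        rw [Real.norm_eq_abs, abs_mul, abs_of_nonneg (show 0 ≤ |S ω| ^ (p - 2) by positivity)]
        rcases le_total |S ω| 1 with h | h
        · have := Real.rpow_le_one (abs_nonneg _) h (show 0 ≤ p - 2 by linarith)
          have := mul_le_one₀ h (by positivity) this
          simp only [Pi.add_apply]
          linarith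
        · have h1 : |S ω| * |S ω| ^ (p - 2) = |S ω| ^ (p - 1) := by
            rw [← Real.rpow_one_add' (abs_nonneg _) (by linarith)]
            congr 1
            ring
          have := Real.rpow_le_rpow_of_exponent_le h (show p - 1 ≤ p by linarith)
          simp only [Pi.add_apply]
          linarith
      have hXint : Integrable (X a) P :=
        (hLp a).integrable (by
          rw [← ENNReal.ofReal_one]
          exact ENNReal.ofReal_le_ofReal (by linarith))
      have hgindep : IndepFun (fun ω => S ω * |S ω| ^ (p - 2)) (X a) P :=
        hindep.comp hgm measurable_id
      have hcross : ∫ ω, S ω * |S ω| ^ (p - 2) * X a ω ∂P = 0 := by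
        rw [hgindep.integral_fun_mul_eq_mul_integral hgint.aestronglyMeasurable
          hXint.aestronglyMeasurable, hmean a, mul_zero]
      have hcrossint : Integrable (fun ω => S ω * |S ω| ^ (p - 2) * X a ω) P :=
        hgindep.integrable_mul hgint hXint
      have hsum : ∀ ω, ∑ i ∈ insert a s, X i ω = S ω + X a ω := fun ω => by
        rw [Finset.sum_insert ha, add_comm]
      simp only [hsum]
      rw [Finset.card_insert_of_notMem ha]
      push_cast
      set t : ℝ := (s.card : ℝ)
      have hmain : Integrable
          (fun ω => (1 + t⁻¹) * |S ω| ^ p + p * (S ω * |S ω| ^ (p - 2) * X a ω)) P :=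
        ((hpow_int hSLp).const_mul _).add (hcrossint.const_mul _)
      calc ∫ ω, |S ω + X a ω| ^ p ∂P
          ≤ ∫ ω, ((1 + t⁻¹) * |S ω| ^ p + p * (S ω * |S ω| ^ (p - 2) * X a ω)
              + B * t ^ (p / 2 - 1) * |X a ω| ^ p) ∂P :=
            integral_mono (hpow_int (hSLp.add (hLp a)))
              (hmain.add ((hpow_int (hLp a)).const_mul _)) fun ω => hTaylor t ht _ _
        _ = (1 + t⁻¹) * ∫ ω, |S ω| ^ p ∂P + B * t ^ (p / 2 - 1) * ∫ ω, |X a ω| ^ p ∂P := by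
            rw [integral_add hmain
              ((hpow_int (hLp a)).const_mul _), integral_add ((hpow_int hSLp).const_mul _)
              (hcrossint.const_mul _), integral_const_mul, integral_const_mul,
              integral_const_mul, hcross, mul_zero, add_zero]
        _ ≤ (1 + t⁻¹) * (K * t ^ (p / 2) * M) + B * t ^ (p / 2 - 1) * M := by
            gcongr
            exact hM a
        _ = ((1 + t⁻¹) * (K * t ^ (p / 2)) + B * t ^ (p / 2 - 1)) * M := by ring
        _ ≤ K * (t + 1) ^ (p / 2) * M :=
            mul_le_mul_of_nonneg_right (add_one_rpow_growth hp ht (by linarith) hKB) hM0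

theorem abs_integral_rpow_le {p : ℝ} (hp : 1 ≤ p) {Ω : Type*} [MeasurableSpace Ω]
    {P : Measure Ω} [IsProbabilityMeasure P] {f : Ω → ℝ} (hf : Integrable f P)
    (hfp : Integrable (fun ω => |f ω| ^ p) P) :
    |∫ ω, f ω ∂P| ^ p ≤ ∫ ω, |f ω| ^ p ∂P :=
  (Real.rpow_le_rpow (abs_nonneg _) abs_integral_le_integral_abs (by linarith)).trans <|
    (convexOn_rpow hp).map_integral_le (Real.continuous_rpow_const (by linarith)).continuousOn
      isClosed_Ici (ae_of_all _ fun ω => abs_nonneg (f ω)) hf.abs hfp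

theorem exists_lintegral_pi_average_sub_mean_rpow_le {p : ℝ} (hp : 2 < p) :
    ∃ C : ℝ, 0 < C ∧ ∀ (ν : Measure ℝ) [IsProbabilityMeasure ν],
      ∫⁻ z, ENNReal.ofReal (|z| ^ p) ∂ν < ⊤ → ∀ n : ℕ, 1 ≤ n →
        ∫⁻ z : Fin n → ℝ, ENNReal.ofReal (|(∑ i, z i) / n - ∫ t, t ∂ν| ^ p)
            ∂(Measure.pi fun _ => ν)
          ≤ ENNReal.ofReal (C * (n : ℝ) ^ (-(p / 2))) * ∫⁻ z, ENNReal.ofReal (|z| ^ p) ∂ν := by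
  obtain ⟨K, hK, hsum⟩ := exists_integral_abs_sum_rpow_le hp
  refine ⟨K * (2 ^ p * 2), by positivity, fun ν _ hν n hn => ?_⟩
  have hp1 : 1 ≤ ENNReal.ofReal p := by
    rw [← ENNReal.ofReal_one]
    exact ENNReal.ofReal_le_ofReal (by linarith)
  have hn0 : (0 : ℝ) < n := by exact_mod_cast hn
  have hpow_int : ∀ {Ω : Type} [MeasurableSpace Ω] {P : Measure Ω} [IsProbabilityMeasure P]
      {Y : Ω → ℝ}, MemLp Y (ENNReal.ofReal p) P → Integrable (fun ω => |Y ω| ^ p) P := fun hY => by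
    simpa [ENNReal.toReal_ofReal (show 0 ≤ p by linarith)] using hY.integrable_norm_rpow'
  have hidp : Integrable (fun z : ℝ => |z| ^ p) ν := by
    refine ⟨Measurable.aestronglyMeasurable (by fun_prop), ?_⟩
    rwa [hasFiniteIntegral_iff_ofReal (ae_of_all _ fun z => by positivity)]
  have hid : MemLp (fun z : ℝ => z) (ENNReal.ofReal p) ν := by
    rw [← integrable_norm_rpow_iff (by fun_prop) (by positivity) ENNReal.ofReal_ne_top]
    simpa [ENNReal.toReal_ofReal (show 0 ≤ p by linarith)] using hidp
  have hid1 : Integrable (fun z : ℝ => z) ν := hid.integrable hp1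
  set m : ℝ := ∫ t, t ∂ν with hm
  set I : ℝ := ∫ z, |z| ^ p ∂ν with hI
  have hlin : ∫⁻ z, ENNReal.ofReal (|z| ^ p) ∂ν = ENNReal.ofReal I :=
    (ofReal_integral_eq_lintegral_ofReal hidp (ae_of_all _ fun z => by positivity)).symm
  have hcLp : MemLp (fun z : ℝ => z - m) (ENNReal.ofReal p) ν := hid.sub (memLp_const m)
  have hcentered : ∫ z, |z - m| ^ p ∂ν ≤ 2 ^ p * 2 * I := by
    calc ∫ z, |z - m| ^ p ∂ν ≤ ∫ z, 2 ^ p * (|z| ^ p + |m| ^ p) ∂ν :=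
          integral_mono (hpow_int hcLp) ((hidp.add (integrable_const _)).const_mul _) fun z => by
            simpa [sub_eq_add_neg] using abs_add_rpow_le (show 0 ≤ p by linarith) z (-m)
      _ = 2 ^ p * (I + |m| ^ p) := by
          rw [integral_const_mul, integral_add hidp (integrable_const _)]
          simp [hI]
      _ ≤ 2 ^ p * (I + I) := by
          gcongr
          exact abs_integral_rpow_le (by linarith) hid1 hidp
      _ = 2 ^ p * 2 * I := by ring
  set Q : Measure (Fin n → ℝ) := Measure.pi fun _ => ν
  have hXLp : ∀ i : Fin n, MemLp (fun z : Fin n → ℝ => z i - m) (ENNReal.ofReal p) Q := fun i =>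
    hcLp.comp_measurePreserving (measurePreserving_eval (fun _ => ν) i)
  have hbound := hsum Q (fun (i : Fin n) z => z i - m)
    (iIndepFun_pi (μ := fun _ : Fin n => ν) (X := fun _ z => z - m) fun i => by fun_prop)
    hXLp
    (fun i => by
      rw [integral_comp_eval (μ := fun _ : Fin n => ν) (f := fun z => z - m) (by fun_prop),
        integral_sub hid1 (integrable_const _)]
      simp [hm])
    (2 ^ p * 2 * I)
    (fun i => by
      rwa [integral_comp_eval (μ := fun _ : Fin n => ν) (f := fun z => |z - m| ^ p)
        (Measurable.aestronglyMeasurable (by fun_prop))])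
    Finset.univ
  rw [Finset.card_fin] at hbound
  have hdiv : ∀ z : Fin n → ℝ,
      |(∑ i, z i) / n - m| ^ p = (n : ℝ) ^ (-p) * |∑ i, (z i - m)| ^ p := fun z => by
    have : (∑ i, z i) / n - m = (∑ i, (z i - m)) / n := by
      rw [Finset.sum_sub_distrib]
      simp
      field_simp
    rw [this, abs_div, Real.div_rpow (abs_nonneg _) (abs_nonneg _), abs_of_pos hn0,
      Real.rpow_neg hn0.le, div_eq_inv_mul]
  have hSint : Integrable (fun z : Fin n → ℝ => |∑ i, (z i - m)| ^ p) Q :=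
    hpow_int (memLp_finsetSum _ fun i _ => hXLp i)
  simp only [hdiv]
  rw [hlin, ← ofReal_integral_eq_lintegral_ofReal (hSint.const_mul _)
    (ae_of_all _ fun z => by positivity), ← ENNReal.ofReal_mul (by positivity), integral_const_mul]
  refine ENNReal.ofReal_le_ofReal ?_
  calc (n : ℝ) ^ (-p) * ∫ z, |∑ i, (z i - m)| ^ p ∂Q
      ≤ (n : ℝ) ^ (-p) * (K * (n : ℝ) ^ (p / 2) * (2 ^ p * 2 * I)) := by gcongr
    _ = K * (2 ^ p * 2) * ((n : ℝ) ^ (-p) * (n : ℝ) ^ (p / 2)) * I := by ring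
    _ = K * (2 ^ p * 2) * (n : ℝ) ^ (-(p / 2)) * I := by
        rw [← Real.rpow_add hn0]
        congr 3
        ring

/-- Conditional Marcinkiewicz–Zygmund inequality in kernel form (Corollary A.2):
for `p > 2` there is `C_p > 0` such that for any probability measure `μ` on `Ω₁`
and Markov kernel `κ : Ω₁ → ℝ` with `∫∫ |z|^p d(κω) dμ(ω) < ∞`, writing
`m(ω) = ∫ z d(κω)(z)`, for every `n ≥ 1`,
`∫∫ |n⁻¹∑zᵢ − m(ω)|^p d(κω)^{⊗n} dμ(ω) ≤ C_p n^{−p/2} ∫∫ |z|^p d(κω) dμ(ω)`. -/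
theorem marcinkiewicz_zygmund_kernel (p : ℝ) (hp : 2 < p) :
    ∃ C : ℝ, 0 < C ∧
      ∀ (Ω₁ : Type*) [MeasurableSpace Ω₁] (μ : Measure Ω₁) [IsProbabilityMeasure μ]
        (κ : Kernel Ω₁ ℝ) [IsMarkovKernel κ],
        (∫⁻ ω, ∫⁻ z, ENNReal.ofReal (|z| ^ p) ∂(κ ω) ∂μ < ⊤) →
        ∀ n : ℕ, 1 ≤ n →
          ∫⁻ ω, ∫⁻ z : Fin n → ℝ,
              ENNReal.ofReal (|(∑ i, z i) / n - ∫ t, t ∂(κ ω)| ^ p)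
                ∂(Measure.pi fun _ => κ ω) ∂μ
            ≤ ENNReal.ofReal (C * (n : ℝ) ^ (-(p / 2)))
              * ∫⁻ ω, ∫⁻ z, ENNReal.ofReal (|z| ^ p) ∂(κ ω) ∂μ := by
  obtain ⟨C, hC, h⟩ := exists_lintegral_pi_average_sub_mean_rpow_le hp
  refine ⟨C, hC, fun Ω₁ _ μ _ κ _ hfin n hn => ?_⟩
  have hmeas : Measurable fun ω => ∫⁻ z, ENNReal.ofReal (|z| ^ p) ∂(κ ω) :=
    Measurable.lintegral_kernel (by fun_prop)
  rw [← lintegral_const_mul _ hmeas]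
  refine lintegral_mono_ae ?_
  filter_upwards [ae_lt_top hmeas hfin.ne] with ω hω
  exact h (κ ω) hω n hn
end

section
/- (Unbiasedness of the randomized multilevel estimator.) Let (Δₙ)_{n∈ℕ} be a sequence of integrable real random variables on a probability space with ∑_{n=0}^∞ E[|Δₙ|] < ∞. Let N be an ℕ-valued random variable, independent of the σ-algebra generated by (Δₙ)_{n∈ℕ}, with pₙ := P(N = n) > 0 for every n. Then the random variable Y := Δ_N / p_N (i.e. ω ↦ Δ_{N(ω)}(ω)/p_{N(ω)}) is integrable and E[Y] = ∑_{n=0}^∞ E[Δₙ]. -/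
open MeasureTheory ProbabilityTheory

/-- Unbiasedness of the randomized multilevel estimator: if `∑ₙ E[|Δₙ|] < ∞` and
`N` is independent of `σ(Δₙ : n ∈ ℕ)` with `pₙ = P(N = n) > 0`, then
`Y = Δ_N / p_N` is integrable with `E[Y] = ∑ₙ E[Δₙ]`. -/
theorem randomized_mlmc_unbiased {Ω : Type*} [MeasurableSpace Ω]
    (μ : Measure Ω) [IsProbabilityMeasure μ]
    (Δ : ℕ → Ω → ℝ) (hΔmeas : ∀ n, Measurable (Δ n))
    (hΔint : ∀ n, Integrable (Δ n) μ)
    (hsum : Summable fun n => ∫ ω, |Δ n ω| ∂μ)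
    (N : Ω → ℕ) (hN : Measurable N)
    (hpos : ∀ n, 0 < μ {ω | N ω = n})
    (hindep : Indep (MeasurableSpace.comap N inferInstance)
      (⨆ n, MeasurableSpace.comap (Δ n) inferInstance) μ) :
    Integrable (fun ω => Δ (N ω) ω / (μ {ω' | N ω' = N ω}).toReal) μ ∧
    ∫ ω, Δ (N ω) ω / (μ {ω' | N ω' = N ω}).toReal ∂μ = ∑' n, ∫ ω, Δ n ω ∂μ := by
  set Y : Ω → ℝ := fun ω => Δ (N ω) ω / (μ {ω' | N ω' = N ω}).toReal
  have hs : ∀ n, MeasurableSet (N ⁻¹' {n}) := fun n => hN (measurableSet_singleton n)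
  have hp : ∀ n, μ.real (N ⁻¹' {n}) ≠ 0 := fun n =>
    (ENNReal.toReal_pos (hpos n).ne' (measure_ne_top μ _)).ne'
  have hYeq : ∀ n, Set.EqOn Y (fun ω => Δ n ω / μ.real (N ⁻¹' {n})) (N ⁻¹' {n}) := by
    rintro n ω rfl
    rfl
  have hunion : ⋃ n, N ⁻¹' {n} = Set.univ := by
    ext ω
    simp
  have hdisj : Pairwise (Function.onFun Disjoint fun n => N ⁻¹' {n}) :=
    pairwise_disjoint_fiber N
  have hset : ∀ (n : ℕ) (f : ℝ → ℝ), Measurable f →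
      ∫ ω in N ⁻¹' {n}, f (Δ n ω) ∂μ = μ.real (N ⁻¹' {n}) * ∫ ω, f (Δ n ω) ∂μ := by
    intro n f hf
    refine Indep.setIntegral_eq_mul hN.comap_le (indep_of_indep_of_le_right hindep
      (le_iSup (fun n => MeasurableSpace.comap (Δ n) inferInstance) n))
      (hΔmeas n).aemeasurable ⟨{n}, measurableSet_singleton n, rfl⟩ hf.aestronglyMeasurable
  have hnorm : ∀ n, ∫ ω in N ⁻¹' {n}, ‖Y ω‖ ∂μ = ∫ ω, |Δ n ω| ∂μ := by
    intro n
    rw [setIntegral_congr_fun (g := fun ω => |Δ n ω| / μ.real (N ⁻¹' {n})) (hs n)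
      fun ω hω => by simp [hYeq n hω, abs_of_nonneg measureReal_nonneg],
      integral_div, hset n (fun x => |x|) (by fun_prop), mul_div_cancel_left₀ _ (hp n)]
  have hmean : ∀ n, ∫ ω in N ⁻¹' {n}, Y ω ∂μ = ∫ ω, Δ n ω ∂μ := by
    intro n
    rw [setIntegral_congr_fun (hs n) (hYeq n), integral_div, hset n (fun x => x) measurable_id,
      mul_div_cancel_left₀ _ (hp n)]
  have hint : IntegrableOn Y (⋃ n, N ⁻¹' {n}) μ := by
    refine integrableOn_iUnion_of_summable_integral_norm (fun n => ?_) (by simpa only [hnorm])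
    exact (integrableOn_congr_fun (hYeq n) (hs n)).mpr ((hΔint n).div_const _).integrableOn
  have hsum_integral := integral_iUnion hs hdisj hint
  rw [hunion, integrableOn_univ] at hint
  rw [hunion, setIntegral_univ] at hsum_integral
  exact ⟨hint, by simpa only [hmean] using hsum_integral⟩
end

section
/- (Moments of the randomized multilevel estimator.) Let (Δₙ)_{n∈ℕ} be a sequence of real random variables on a probability space, let q ≥ 1 be real, and let N be an ℕ-valued random variable, independent of the σ-algebra generated by (Δₙ)_{n∈ℕ}, with pₙ := P(N = n) > 0 for every n. Then, as an identity in [0, ∞], E[|Δ_N / p_N|^q] = ∑_{n=0}^∞ E[|Δₙ|^q] / pₙ^{q−1}. In particular, if ∑_{n=0}^∞ E[|Δₙ|^q]/pₙ^{q−1} < ∞ then Δ_N/p_N has finite q-th absolute moment. -/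
open MeasureTheory ProbabilityTheory

/-- Evaluating a sequence of nonnegative random variables at a random index independent of each
of them: the expectation is the mixture of the individual expectations. -/
theorem lintegral_randomIndex_eq_tsum {Ω : Type*} [MeasurableSpace Ω] {μ : Measure Ω}
    {F : ℕ → Ω → ENNReal} (hF : ∀ n, Measurable (F n)) {N : Ω → ℕ} (hN : Measurable N)
    (hindep : ∀ n, IndepFun (F n) N μ) :
    ∫⁻ ω, F (N ω) ω ∂μ = ∑' n, (∫⁻ ω, F n ω ∂μ) * μ {ω | N ω = n} := by
  have hind (n : ℕ) : Measurable (({n} : Set ℕ).indicator (1 : ℕ → ENNReal)) :=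
    measurable_from_top
  have hsum (ω : Ω) : F (N ω) ω = ∑' n, F n ω * ({n} : Set ℕ).indicator 1 (N ω) := by
    rw [tsum_eq_single (N ω) fun n hn => by simp [hn.symm]]
    simp
  simp_rw [hsum]
  refine (lintegral_tsum fun n => ((hF n).mul ((hind n).comp hN)).aemeasurable).trans ?_
  congr 1 with n
  have hmul := lintegral_mul_eq_lintegral_mul_lintegral_of_indepFun (hF n) ((hind n).comp hN)
    ((hindep n).comp measurable_id (hind n))
  have hprob : ∫⁻ ω, (({n} : Set ℕ).indicator (1 : ℕ → ENNReal) ∘ N) ω ∂μ = μ {ω | N ω = n} :=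
    lintegral_indicator_one (hN (measurableSet_singleton n))
  rw [hprob] at hmul
  exact hmul

/-- The weight identity `|x / p| ^ q * p = |x| ^ q / p ^ (q - 1)` for `p > 0`. -/
theorem abs_div_rpow_mul_self (x q : ℝ) {p : ℝ} (hp : 0 < p) :
    |x / p| ^ q * p = |x| ^ q / p ^ (q - 1) := by
  rw [abs_div, abs_of_pos hp, Real.div_rpow (abs_nonneg x) hp.le, Real.rpow_sub_one hp.ne']
  field_simp

/-- Moments of the randomized multilevel estimator: for `q ≥ 1`, if `N` is
independent of `σ(Δₙ : n ∈ ℕ)` with `pₙ = P(N = n) > 0`, then, as an identity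
in `[0,∞]`, `E[|Δ_N/p_N|^q] = ∑ₙ E[|Δₙ|^q]/pₙ^{q−1}`. -/
theorem randomized_mlmc_moment {Ω : Type*} [MeasurableSpace Ω]
    (μ : Measure Ω) [IsProbabilityMeasure μ]
    (Δ : ℕ → Ω → ℝ) (hΔmeas : ∀ n, Measurable (Δ n))
    (q : ℝ) (hq : 1 ≤ q)
    (N : Ω → ℕ) (hN : Measurable N)
    (hpos : ∀ n, 0 < μ {ω | N ω = n})
    (hindep : Indep (MeasurableSpace.comap N inferInstance)
      (⨆ n, MeasurableSpace.comap (Δ n) inferInstance) μ) :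
    ∫⁻ ω, ENNReal.ofReal (|Δ (N ω) ω / (μ {ω' | N ω' = N ω}).toReal| ^ q) ∂μ
      = ∑' n, (∫⁻ ω, ENNReal.ofReal (|Δ n ω| ^ q) ∂μ)
          / ENNReal.ofReal ((μ {ω | N ω = n}).toReal ^ (q - 1)) := by
  have hF (n : ℕ) : Measurable fun x : ℝ =>
      ENNReal.ofReal (|x / (μ {ω | N ω = n}).toReal| ^ q) := by fun_prop
  have hle (n : ℕ) : MeasurableSpace.comap (Δ n) inferInstance ≤
      ⨆ n, MeasurableSpace.comap (Δ n) inferInstance :=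
    le_iSup (fun n => MeasurableSpace.comap (Δ n) inferInstance) n
  have hΔN (n : ℕ) : IndepFun (Δ n) N μ :=
    (IndepFun_iff_Indep _ _ _).2 (indep_of_indep_of_le_right hindep (hle n)).symm
  rw [lintegral_randomIndex_eq_tsum
    (F := fun n ω => ENNReal.ofReal (|Δ n ω / (μ {ω' | N ω' = n}).toReal| ^ q))
    (fun n => (hF n).comp (hΔmeas n)) hN
    fun n => (hΔN n).comp (hF n) measurable_id]
  congr 1 with n
  have hp : 0 < (μ {ω | N ω = n}).toReal :=
    ENNReal.toReal_pos (hpos n).ne' (measure_ne_top μ _)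
  rw [← lintegral_mul_const _ (by fun_prop), div_eq_mul_inv,
    ← lintegral_mul_const _ (by fun_prop)]
  refine lintegral_congr fun ω => ?_
  rw [← div_eq_mul_inv, ← ENNReal.ofReal_div_of_pos (Real.rpow_pos_of_pos hp _),
    ← abs_div_rpow_mul_self _ _ hp, ENNReal.ofReal_mul (by positivity),
    ENNReal.ofReal_toReal (measure_ne_top μ _)]
end

section
/- Let a, m, x, y be real numbers and ε > 0. If |m − a| ≥ ε, |x − m| ≤ ε/2 and |x − y| ≤ ε/2, then max{a, (x+y)/2} = (1/2)(max{a, x} + max{a, y}); equivalently the antithetic difference max{a,(x+y)/2} − (1/2)(max{a,x}+max{a,y}) equals 0. (This is the key deterministic step in the proof of Theorem 1: on the complement of the events E₁ ∪ E₂ ∪ E₃ the term Δₙ vanishes.) -/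
/-- Key deterministic step in the proof of Theorem 1: on the complement of
`E₁ ∪ E₂ ∪ E₃` the antithetic difference vanishes. -/
theorem antithetic_difference_vanishes (a m x y ε : ℝ) (hε : 0 < ε)
    (h1 : ε ≤ |m - a|) (h2 : |x - m| ≤ ε / 2) (h3 : |x - y| ≤ ε / 2) :
    max a ((x + y) / 2) = (max a x + max a y) / 2 := by
  rw [abs_le] at h2 h3
  rcases le_abs.mp h1 with h | h
  · have hx : a ≤ x := by linarith
    have hy : a ≤ y := by linarith
    rw [max_eq_right hx, max_eq_right hy, max_eq_right (by linarith)]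
  · have hx : x ≤ a := by linarith
    have hy : y ≤ a := by linarith
    rw [max_eq_left hx, max_eq_left hy, max_eq_left (by linarith), add_self_div_two]
end

section
/- Let δ > 0 and L > 0. Suppose f is Borel measurable with |f(x)| ≤ L(1 + ‖x‖) for all x ∈ 𝒳 and that M := ∫ ∫ ‖y‖^{2+δ} d(κ x)(y) dπ₁(x) < ∞. Then there exists a constant c > 0, depending only on δ, such that for every n ≥ 1: ∫_𝒳 ∫ |Δₙ(x,z)| d(κ x)^{⊗2ⁿ}(z) dπ₁(x) ≤ c · L · (1 + M)^{1/(2+δ)} · 2^{−n/2}. In particular ∑_{n=1}^∞ ∫∫ |Δₙ| < ∞, which legitimizes interchanging summation and expectation in the unbiasedness proof. -/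
open MeasureTheory ProbabilityTheory

noncomputable section

variable {X : Type*}

lemma eLpNorm_two_eq_ofReal_sqrt {Ω : Type*} [MeasurableSpace Ω] {μ : Measure Ω} {g : Ω → ℝ}
    (hg : MemLp g 2 μ) : eLpNorm g 2 μ = ENNReal.ofReal (√(∫ ω, g ω ^ 2 ∂μ)) := by
  rw [hg.eLpNorm_eq_integral_rpow_norm (by norm_num) (by norm_num), Real.sqrt_eq_rpow]
  norm_num

/-- A balanced sum with unit-square weights of `card ι` independent copies of `f` has `L²` norm at
most `√(card ι)` times that of `f`. -/
lemma eLpNorm_balanced_sum_le {Ω ι : Type*} [MeasurableSpace Ω] [Fintype ι] [Nonempty ι]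
    (μ : Measure Ω) [IsProbabilityMeasure μ] {f : Ω → ℝ} (hf : Measurable f) {s : ι → ℝ}
    (hs : ∀ i, s i ^ 2 = 1) (hs0 : ∑ i, s i = 0) :
    eLpNorm (fun z : ι → Ω => ∑ i, s i * f (z i)) 2 (Measure.pi fun _ => μ)
      ≤ ENNReal.ofReal (√(Fintype.card ι)) * eLpNorm f 2 μ := by
  by_cases hmem : MemLp f 2 μ
  swap
  · have htop : eLpNorm f 2 μ = ⊤ := by
      by_contra h
      exact hmem ⟨hf.aestronglyMeasurable, lt_top_iff_ne_top.2 h⟩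
    have hcard : 0 < √(Fintype.card ι : ℝ) := Real.sqrt_pos.2 (by exact_mod_cast Fintype.card_pos)
    rw [htop, ENNReal.mul_top (by simpa using hcard)]
    exact le_top
  have hmi : ∀ i, MemLp (fun y => s i * f y) 2 μ := fun i => hmem.const_mul _
  have hmS : MemLp (fun z : ι → Ω => ∑ i, s i * f (z i)) 2 (Measure.pi fun _ => μ) :=
    memLp_finsetSum _ fun i _ =>
      (hmi i).comp_measurePreserving (measurePreserving_eval (fun _ : ι => μ) i)
  have hmean : ∫ z : ι → Ω, ∑ i, s i * f (z i) ∂(Measure.pi fun _ => μ) = 0 := by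
    rw [integral_finsetSum]
    · have h (i : ι) : ∫ z : ι → Ω, s i * f (z i) ∂(Measure.pi fun _ => μ)
          = s i * ∫ y, f y ∂μ := by
        rw [integral_const_mul,
          integral_comp_eval (μ := fun _ : ι => μ) hf.aestronglyMeasurable]
      simp_rw [h, ← Finset.sum_mul, hs0, zero_mul]
    · exact fun i _ => integrable_comp_eval (μ := fun _ : ι => μ) (f := fun y => s i * f y)
        ((hmi i).integrable one_le_two)
  have hvar := variance_sum_pi (μ := fun _ : ι => μ) (X := fun i y => s i * f y) hmi
  have hfun : (∑ i, fun z : ι → Ω => s i * f (z i)) = fun z => ∑ i, s i * f (z i) := by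
    ext z; simp
  rw [hfun, variance_of_integral_eq_zero hmS.aemeasurable hmean] at hvar
  simp_rw [variance_const_mul, hs, one_mul, Finset.sum_const, Finset.card_univ,
    nsmul_eq_mul] at hvar
  rw [eLpNorm_two_eq_ofReal_sqrt hmS, eLpNorm_two_eq_ofReal_sqrt hmem,
    ← ENNReal.ofReal_mul (Real.sqrt_nonneg _), ← Real.sqrt_mul (Nat.cast_nonneg _)]
  refine ENNReal.ofReal_le_ofReal (Real.sqrt_le_sqrt ?_)
  refine hvar.le.trans ?_
  gcongr
  exact variance_le_expectation_sq hf.aestronglyMeasurable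

lemma abs_max_add_half_sub_le (a o e : ℝ) :
    |max a ((o + e) / 2) - (max a o + max a e) / 2| ≤ |o - e| / 2 := by
  rcases max_cases a ((o + e) / 2) with ⟨h1, _⟩ | ⟨h1, _⟩ <;>
  rcases max_cases a o with ⟨h2, _⟩ | ⟨h2, _⟩ <;>
  rcases max_cases a e with ⟨h3, _⟩ | ⟨h3, _⟩ <;>
  rcases abs_cases (o - e) with ⟨h4, _⟩ | ⟨h4, _⟩ <;>
  rw [h1, h2, h3, h4, abs_le] <;> constructor <;> linarith

lemma sum_range_two_mul {M : Type*} [AddCommMonoid M] (g : ℕ → M) (m : ℕ) :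
    ∑ i ∈ Finset.range (2 * m), g i
      = ∑ j ∈ Finset.range m, g (2 * j) + ∑ j ∈ Finset.range m, g (2 * j + 1) := by
  induction m with
  | zero => simp
  | succ m ih =>
    rw [Nat.mul_succ, Finset.sum_range_succ, Finset.sum_range_succ, ih, Finset.sum_range_succ,
      Finset.sum_range_succ]
    abel

lemma abs_antitheticDelta_le {Y : Type*} (f : Y → ℝ) (n : ℕ) (x : Y)
    (z : Fin (2 ^ (n + 1)) → Y) :
    |antitheticDelta f (n + 1) x (tupleExt (n + 1) z)|
      ≤ (2 ^ (n + 1))⁻¹ * |∑ i : Fin (2 ^ (n + 1)), (-1) ^ (i : ℕ) * f (z i)| := by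
  set w := tupleExt (n + 1) z with hw
  have hfull : avgFull f (n + 1) w = (avgOdd f (n + 1) w + avgEven f (n + 1) w) / 2 := by
    simp only [avgFull, avgOdd, avgEven, Nat.add_sub_cancel]
    rw [pow_succ' 2 n, sum_range_two_mul]
    field_simp
    ring
  have hsum : ∑ i : Fin (2 ^ (n + 1)), (-1) ^ (i : ℕ) * f (z i)
      = 2 ^ n * (avgOdd f (n + 1) w - avgEven f (n + 1) w) := by
    have h (i : Fin (2 ^ (n + 1))) : z i = w i := by
      simp [hw, tupleExt, Nat.mod_eq_of_lt i.2]
    simp_rw [h]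
    rw [← Finset.sum_range fun i => (-1 : ℝ) ^ i * f (w i), pow_succ' 2 n, sum_range_two_mul]
    simp only [avgOdd, avgEven, Nat.add_sub_cancel, pow_succ, pow_mul]
    field_simp
    simp
    ring
  have hpos : (0 : ℝ) < 2 ^ n := by positivity
  rw [antitheticDelta, if_neg n.succ_ne_zero, hfull, hsum, abs_mul, abs_of_pos hpos]
  refine (abs_max_add_half_sub_le _ _ _).trans (le_of_eq ?_)
  rw [pow_succ]
  field_simp

/-- For a fixed starting point the antithetic difference has `L¹` norm at most `2^{-n/2}` times the
`L²` norm of `f`. -/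
lemma lintegral_abs_antitheticDelta_le {Y : Type*} [MeasurableSpace Y] (μ : Measure Y)
    [IsProbabilityMeasure μ] {f : Y → ℝ} (hf : Measurable f) {n : ℕ} (hn : 1 ≤ n) (x : Y) :
    ∫⁻ z : Fin (2 ^ n) → Y, ENNReal.ofReal |antitheticDelta f n x (tupleExt n z)|
        ∂(Measure.pi fun _ => μ)
      ≤ ENNReal.ofReal (2 ^ (-(n : ℝ) / 2)) * eLpNorm f 2 μ := by
  obtain ⟨n, rfl⟩ := Nat.exists_eq_add_of_le' hn
  set S : (Fin (2 ^ (n + 1)) → Y) → ℝ := fun z =>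
    ∑ i : Fin (2 ^ (n + 1)), (-1) ^ (i : ℕ) * f (z i)
  have hSm : Measurable S := by unfold S; fun_prop
  have hs0 : ∑ i : Fin (2 ^ (n + 1)), (-1 : ℝ) ^ (i : ℕ) = 0 := by
    rw [← Finset.sum_range fun i => (-1 : ℝ) ^ i, pow_succ' 2 n, sum_range_two_mul]
    simp [pow_succ, pow_mul]
  calc _ ≤ ∫⁻ z, ENNReal.ofReal (2 ^ (n + 1))⁻¹ * ‖S z‖ₑ ∂(Measure.pi fun _ => μ) := by
        refine lintegral_mono fun z => ?_
        rw [← ofReal_norm, Real.norm_eq_abs, ← ENNReal.ofReal_mul (by positivity)]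
        exact ENNReal.ofReal_le_ofReal (abs_antitheticDelta_le f n x z)
    _ = ENNReal.ofReal (2 ^ (n + 1))⁻¹ * eLpNorm S 1 (Measure.pi fun _ => μ) := by
        rw [lintegral_const_mul _ hSm.enorm, eLpNorm_one_eq_lintegral_enorm]
    _ ≤ ENNReal.ofReal (2 ^ (n + 1))⁻¹ * eLpNorm S 2 (Measure.pi fun _ => μ) := by
        gcongr
        exact eLpNorm_le_eLpNorm_of_exponent_le one_le_two hSm.aestronglyMeasurable
    _ ≤ ENNReal.ofReal (2 ^ (n + 1))⁻¹ *
          (ENNReal.ofReal (√(Fintype.card (Fin (2 ^ (n + 1))))) * eLpNorm f 2 μ) := by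
        gcongr
        refine eLpNorm_balanced_sum_le μ hf (fun i => ?_) hs0
        rw [← pow_mul, mul_comm, pow_mul]
        simp
    _ = _ := by
        rw [← mul_assoc, ← ENNReal.ofReal_mul (by positivity)]
        congr 2
        rw [Fintype.card_fin, Real.sqrt_eq_rpow, Nat.cast_pow, Nat.cast_two, ← Real.rpow_natCast,
          ← Real.rpow_mul zero_le_two, ← Real.rpow_neg zero_le_two, ← Real.rpow_add two_pos]
        congr 1
        ring

/-- The `L²` norms of `f` along the kernel average to at most the `L²` norm under the composed
measure. -/
lemma lintegral_eLpNorm_two_le {Y : Type*} [MeasurableSpace Y] (π₁ : Measure Y)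
    [IsProbabilityMeasure π₁] (κ : Kernel Y Y) {f : Y → ℝ} (hf : Measurable f) :
    ∫⁻ x, eLpNorm f 2 (κ x) ∂π₁ ≤ eLpNorm f 2 (π₁.bind κ) := by
  have hm : Measurable fun x => ∫⁻ y, ‖f y‖ₑ ^ (2 : ℝ) ∂(κ x) :=
    (hf.enorm.pow_const _).lintegral_kernel
  have h (ν : Measure Y) : eLpNorm f 2 ν = (∫⁻ y, ‖f y‖ₑ ^ (2 : ℝ) ∂ν) ^ (1 / 2 : ℝ) := by
    rw [eLpNorm_eq_lintegral_rpow_enorm_toReal (by norm_num) (by norm_num), ENNReal.toReal_ofNat]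
  simp_rw [h]
  rw [Measure.lintegral_bind κ.measurable.aemeasurable (hf.enorm.pow_const _).aemeasurable]
  have := eLpNorm_le_eLpNorm_of_exponent_le (μ := π₁) (p := 1) (q := 2) one_le_two
    (hm.pow_const (1 / 2 : ℝ)).aestronglyMeasurable
  rw [eLpNorm_one_eq_lintegral_enorm,
    eLpNorm_eq_lintegral_rpow_enorm_toReal (by norm_num) (by norm_num)] at this
  simpa only [enorm_eq_self, ENNReal.toReal_ofNat, ← ENNReal.rpow_mul, one_div,
    inv_mul_cancel₀ (two_ne_zero' ℝ), ENNReal.rpow_one] using this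

/-- A function of linear growth is bounded in `L²` by the moment of order `2 + δ`. -/
lemma eLpNorm_two_le_of_linear_growth {Y : Type*} [NormedAddCommGroup Y] [MeasurableSpace Y]
    [OpensMeasurableSpace Y] (ν : Measure Y) [IsProbabilityMeasure ν] {δ : ℝ} (hδ : 0 < δ)
    {f : Y → ℝ} {L : ℝ} (hL : 0 < L) (hgrowth : ∀ x, |f x| ≤ L * (1 + ‖x‖))
    (hmom : ∫⁻ y, ENNReal.ofReal (‖y‖ ^ (2 + δ)) ∂ν ≠ ⊤) :
    eLpNorm f 2 ν ≤ ENNReal.ofReal (2 * L *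
      (1 + (∫⁻ y, ENNReal.ofReal (‖y‖ ^ (2 + δ)) ∂ν).toReal) ^ (1 / (2 + δ))) := by
  set M := (∫⁻ y, ENNReal.ofReal (‖y‖ ^ (2 + δ)) ∂ν).toReal with hM
  have hM0 : 0 ≤ M := ENNReal.toReal_nonneg
  set p := ENNReal.ofReal (2 + δ) with hp
  have hp2 : 2 ≤ p := by
    rw [hp, ← ENNReal.ofReal_ofNat]
    exact ENNReal.ofReal_le_ofReal (by linarith)
  have hp0 : p ≠ 0 := (two_pos.trans_le hp2).ne'
  have hpt : p.toReal = 2 + δ := ENNReal.toReal_ofReal (by linarith)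
  have hnm : Measurable fun y : Y => ‖y‖ := measurable_norm
  have hnorm : eLpNorm (fun y : Y => ‖y‖) p ν = ENNReal.ofReal (M ^ (1 / (2 + δ))) := by
    rw [eLpNorm_eq_lintegral_rpow_enorm_toReal hp0 ENNReal.ofReal_ne_top, hpt,
      ← ENNReal.ofReal_rpow_of_nonneg hM0 (by positivity), hM, ENNReal.ofReal_toReal hmom]
    congr 1
    refine lintegral_congr fun y => ?_
    rw [enorm_norm, ← ofReal_norm, ENNReal.ofReal_rpow_of_nonneg (norm_nonneg _) (by positivity)]
  have hone : 1 ≤ (1 + M) ^ (1 / (2 + δ)) := Real.one_le_rpow (by linarith) (by positivity)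
  have hle : M ^ (1 / (2 + δ)) ≤ (1 + M) ^ (1 / (2 + δ)) :=
    Real.rpow_le_rpow hM0 (by linarith) (by positivity)
  calc eLpNorm f 2 ν ≤ eLpNorm (fun y : Y => L * (1 + ‖y‖)) 2 ν := eLpNorm_mono_real hgrowth
    _ ≤ eLpNorm (fun y : Y => L * (1 + ‖y‖)) p ν :=
        eLpNorm_le_eLpNorm_of_exponent_le hp2
          ((hnm.const_add 1).const_mul L).aestronglyMeasurable
    _ = ENNReal.ofReal L * eLpNorm ((fun _ : Y => (1 : ℝ)) + fun y => ‖y‖) p ν := by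
        rw [← Real.enorm_of_nonneg hL.le, ← eLpNorm_const_smul]
        rfl
    _ ≤ ENNReal.ofReal L * (1 + ENNReal.ofReal (M ^ (1 / (2 + δ)))) := by
        gcongr
        refine (eLpNorm_add_le aestronglyMeasurable_const hnm.aestronglyMeasurable
          (one_le_two.trans hp2)).trans ?_
        rw [hnorm, eLpNorm_const _ hp0 (IsProbabilityMeasure.ne_zero ν)]
        simp
    _ ≤ _ := by
        rw [← ENNReal.ofReal_one, ← ENNReal.ofReal_add zero_le_one (by positivity),
          ← ENNReal.ofReal_mul hL.le]
        refine ENNReal.ofReal_le_ofReal ?_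
        nlinarith

lemma summable_two_rpow_neg_succ_half :
    Summable fun n : ℕ => (2 : ℝ) ^ (-((n + 1 : ℕ) : ℝ) / 2) := by
  have h (n : ℕ) : (2 : ℝ) ^ (-((n + 1 : ℕ) : ℝ) / 2) = ((2 : ℝ) ^ (-(1 / 2) : ℝ)) ^ (n + 1) := by
    rw [← Real.rpow_natCast, ← Real.rpow_mul zero_le_two]
    congr 1
    ring
  simp_rw [h]
  exact (summable_nat_add_iff 1).2 (summable_geometric_of_lt_one (by positivity)
    (Real.rpow_lt_one_of_one_lt_of_neg one_lt_two (by norm_num)))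

/-- L¹ bound on the antithetic differences: there is a constant `c` depending only
on `δ` with `∫∫|Δₙ| ≤ c · L · (1+M)^{1/(2+δ)} · 2^{−n/2}` for all `n ≥ 1`; in
particular `∑_{n≥1} ∫∫|Δₙ| < ∞`, legitimizing the interchange of summation and
expectation in the unbiasedness proof. -/
theorem muse_delta_L1_bound (δ : ℝ) (hδ : 0 < δ) :
    ∃ c : ℝ, 0 < c ∧
      ∀ (X : Type*) [NormedAddCommGroup X] [NormedSpace ℝ X] [MeasurableSpace X]
        [BorelSpace X] [TopologicalSpace.SeparableSpace X]
        (π₁ : Measure X) [IsProbabilityMeasure π₁]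
        (κ : Kernel X X) [IsMarkovKernel κ] (f : X → ℝ) (L : ℝ), 0 < L →
        Measurable f → (∀ x, |f x| ≤ L * (1 + ‖x‖)) →
        (∫⁻ x, ∫⁻ y, ENNReal.ofReal (‖y‖ ^ (2 + δ)) ∂(κ x) ∂π₁ ≠ ⊤) →
        (∀ n : ℕ, 1 ≤ n →
          ∫⁻ x, ∫⁻ z : Fin (2 ^ n) → X,
              ENNReal.ofReal |antitheticDelta f n x (tupleExt n z)|
                ∂(Measure.pi fun _ => κ x) ∂π₁
            ≤ ENNReal.ofReal (c * L
                * (1 + (∫⁻ x, ∫⁻ y, ENNReal.ofReal (‖y‖ ^ (2 + δ)) ∂(κ x) ∂π₁).toReal)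
                    ^ (1 / (2 + δ))
                * 2 ^ (-(n : ℝ) / 2))) ∧
        ∑' n : ℕ,
            ∫⁻ x, ∫⁻ z : Fin (2 ^ (n + 1)) → X,
              ENNReal.ofReal |antitheticDelta f (n + 1) x (tupleExt (n + 1) z)|
                ∂(Measure.pi fun _ => κ x) ∂π₁ < ⊤ := by
  refine ⟨2, two_pos, ?_⟩
  intro X _ _ _ _ _ π₁ _ κ _ f L hL hf hgrowth hmom
  have hbind : ∫⁻ y, ENNReal.ofReal (‖y‖ ^ (2 + δ)) ∂(π₁.bind κ)
      = ∫⁻ x, ∫⁻ y, ENNReal.ofReal (‖y‖ ^ (2 + δ)) ∂(κ x) ∂π₁ :=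
    Measure.lintegral_bind κ.measurable.aemeasurable
      (measurable_norm.pow_const _).ennreal_ofReal.aemeasurable
  rw [← hbind] at hmom ⊢
  have hbound : ∀ n : ℕ, 1 ≤ n →
      ∫⁻ x, ∫⁻ z : Fin (2 ^ n) → X, ENNReal.ofReal |antitheticDelta f n x (tupleExt n z)|
          ∂(Measure.pi fun _ => κ x) ∂π₁
        ≤ ENNReal.ofReal (2 * L
            * (1 + (∫⁻ y, ENNReal.ofReal (‖y‖ ^ (2 + δ)) ∂(π₁.bind κ)).toReal) ^ (1 / (2 + δ))
            * 2 ^ (-(n : ℝ) / 2)) := by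
    intro n hn
    refine (lintegral_mono fun x => lintegral_abs_antitheticDelta_le (κ x) hf hn x).trans ?_
    rw [lintegral_const_mul' _ _ ENNReal.ofReal_ne_top, mul_comm,
      ENNReal.ofReal_mul (by positivity)]
    gcongr
    exact (lintegral_eLpNorm_two_le π₁ κ hf).trans
      (eLpNorm_two_le_of_linear_growth (π₁.bind κ) hδ hL hgrowth hmom)
  exact ⟨hbound, (ENNReal.tsum_le_tsum fun n => hbound (n + 1) n.succ_pos).trans_lt
    (summable_two_rpow_neg_succ_half.mul_left _).tsum_ofReal_lt_top⟩
end
end
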